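/- arXiv:2411.01482 — 7 statements merged into one kernel-verified Lean document; each statement's English description precedes it below -/
import Mathlib

section
/- Let d ≥ 1, let K ⊂ ℝ^d be an open convex body, let γ ∈ (0, 1/2] be such that B(o,γ) ⊂ K ⊂ B(o,1/2), and let δ ∈ (0, 1/2] be such that the origin o lies in K_δ. Then B_K(o, (1/(2d))·ln(1/δ) + (1/(2d))·ln(2^{2d−1}·γ^{3d}·ω_d/|K|)) ⊆ K_δ ⊆ B_K(o, (1/2)·ln(1/δ) + (1/2)·ln(d(1+2γ)/(4√3·γ²·|K|))). -/
open MeasureTheory Metric Bornology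
open scoped InnerProductSpace Pointwise

noncomputable def halfspaceDepth {d : ℕ} (K : Set (EuclideanSpace ℝ (Fin d)))
    (q : EuclideanSpace ℝ (Fin d)) : ℝ :=
  ⨅ v : {v : EuclideanSpace ℝ (Fin d) // ‖v‖ = 1},
    (volume {z : EuclideanSpace ℝ (Fin d) | z ∈ K ∧ 0 ≤ ⟪(v : EuclideanSpace ℝ (Fin d)), z - q⟫_ℝ}).toReal
      / (volume K).toReal

def depthRegion {d : ℕ} (K : Set (EuclideanSpace ℝ (Fin d))) (δ : ℝ) :
    Set (EuclideanSpace ℝ (Fin d)) :=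
  {q | δ ≤ halfspaceDepth K q}

noncomputable def hilbertDist {d : ℕ} (K : Set (EuclideanSpace ℝ (Fin d)))
    (p q : EuclideanSpace ℝ (Fin d)) : ℝ :=
  sInf {r : ℝ | (p = q ∧ r = 0) ∨
    ∃ a b : EuclideanSpace ℝ (Fin d), a ∈ frontier K ∧ b ∈ frontier K ∧
      (∃ t : ℝ, t < 0 ∧ a = p + t • (q - p)) ∧
      (∃ s : ℝ, 1 < s ∧ b = p + s • (q - p)) ∧
      r = (1 / 2) * Real.log ((‖q - a‖ * ‖p - b‖) / (‖p - a‖ * ‖q - b‖))}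

def hilbertBall {d : ℕ} (K : Set (EuclideanSpace ℝ (Fin d)))
    (x : EuclideanSpace ℝ (Fin d)) (r : ℝ) : Set (EuclideanSpace ℝ (Fin d)) :=
  {y | 0 < r ∧ y ∈ K ∧ hilbertDist K x y < r}

noncomputable def omegaBall (d : ℕ) : ℝ :=
  (volume (Metric.ball (0 : EuclideanSpace ℝ (Fin d)) 1)).toReal

def dilate {d : ℕ} (lam : ℝ) (K : Set (EuclideanSpace ℝ (Fin d))) :
    Set (EuclideanSpace ℝ (Fin d)) :=
  {y | 0 < lam ∧ y ∈ lam • K}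

theorem bddBelow_halfspaceFractions {d : ℕ} (K : Set (EuclideanSpace ℝ (Fin d)))
    (q : EuclideanSpace ℝ (Fin d)) :
    BddBelow (Set.range fun v : {v : EuclideanSpace ℝ (Fin d) // ‖v‖ = 1} =>
      (volume {z : EuclideanSpace ℝ (Fin d) |
        z ∈ K ∧ 0 ≤ ⟪(v : EuclideanSpace ℝ (Fin d)), z - q⟫_ℝ}).toReal / (volume K).toReal) :=
  ⟨0, by rintro _ ⟨v, rfl⟩; positivity⟩

theorem exists_unit_inner_lt_of_notMem {d : ℕ} {K : Set (EuclideanSpace ℝ (Fin d))}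
    (hne : K.Nonempty) (hopen : IsOpen K) (hconv : Convex ℝ K)
    {x : EuclideanSpace ℝ (Fin d)} (hx : x ∉ K) :
    ∃ v : EuclideanSpace ℝ (Fin d), ‖v‖ = 1 ∧ ∀ z ∈ K, ⟪v, z⟫_ℝ < ⟪v, x⟫_ℝ := by
  obtain ⟨f, hf⟩ := geometric_hahn_banach_open_point hconv hopen hx
  set w := (InnerProductSpace.toDual ℝ (EuclideanSpace ℝ (Fin d))).symm f with hw
  have hfw : ∀ z, f z = ⟪w, z⟫_ℝ := fun z => by
    rw [hw, InnerProductSpace.toDual_symm_apply]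
  have hw0 : w ≠ 0 := by
    intro h
    obtain ⟨z, hz⟩ := hne
    have := hf z hz
    simp [hfw, h] at this
  have hpos : 0 < ‖w‖⁻¹ := inv_pos.2 (norm_pos_iff.2 hw0)
  refine ⟨‖w‖⁻¹ • w, ?_, fun z hz => ?_⟩
  · rw [norm_smul, norm_inv, norm_norm, inv_mul_cancel₀ (norm_ne_zero_iff.2 hw0)]
  · rw [real_inner_smul_left, real_inner_smul_left, ← hfw, ← hfw]
    exact mul_lt_mul_of_pos_left (hf z hz) hpos

theorem volume_le_of_subset_slab {d : ℕ} {S : Set (EuclideanSpace ℝ (Fin d))}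
    {v : EuclideanSpace ℝ (Fin d)} (hv : ‖v‖ = 1) {c e : ℝ}
    (hnorm : ∀ z ∈ S, ‖z‖ ≤ 1 / 2) (hslab : ∀ z ∈ S, c ≤ ⟪v, z⟫_ℝ ∧ ⟪v, z⟫_ℝ ≤ e) :
    volume S ≤ ENNReal.ofReal (e - c) := by
  have hd : 0 < d := by
    rcases Nat.eq_zero_or_pos d with rfl | h
    · rw [Subsingleton.elim v 0] at hv
      simp at hv
    · exact h
  let i₀ : Fin d := ⟨0, hd⟩
  obtain ⟨b, hb⟩ := Orthonormal.exists_orthonormalBasis_extension_of_card_eq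
    (𝕜 := ℝ) (E := EuclideanSpace ℝ (Fin d)) (ι := Fin d) (by simp)
    (v := fun _ => v) (s := {i₀}) (by
      constructor
      · intro i
        simpa using hv
      · intro i j hij
        exact absurd (Subsingleton.elim i j) hij)
  have hb₀ : b i₀ = v := hb i₀ rfl
  let lo : Fin d → ℝ := Function.update (fun _ => -(1 / 2)) i₀ c
  let hi : Fin d → ℝ := Function.update (fun _ => 1 / 2) i₀ e
  have hmp : MeasurePreserving (fun z => WithLp.ofLp (b.repr z)) volume volume :=
    (PiLp.volume_preserving_ofLp (Fin d)).comp b.measurePreserving_repr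
  have hsub : S ⊆ (fun z => WithLp.ofLp (b.repr z)) ⁻¹' Set.Icc lo hi := by
    intro z hz
    have key : ∀ i, lo i ≤ (b.repr z) i ∧ (b.repr z) i ≤ hi i := by
      intro i
      by_cases hi' : i = i₀
      · subst hi'
        simp only [lo, hi, Function.update_self, b.repr_apply_apply, hb₀]
        exact hslab z hz
      · simp only [lo, hi, Function.update_of_ne hi', b.repr_apply_apply]
        have h1 : |⟪b i, z⟫_ℝ| ≤ 1 / 2 := by
          refine (abs_real_inner_le_norm _ _).trans ?_
          rw [b.norm_eq_one, one_mul]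
          exact hnorm z hz
        exact abs_le.1 h1
    exact ⟨fun i => (key i).1, fun i => (key i).2⟩
  calc volume S ≤ volume ((fun z => WithLp.ofLp (b.repr z)) ⁻¹' Set.Icc lo hi) :=
        measure_mono hsub
    _ = volume (Set.Icc lo hi) := hmp.measure_preimage measurableSet_Icc.nullMeasurableSet
    _ = ENNReal.ofReal (e - c) := by
        rw [Real.volume_Icc_pi, Finset.prod_eq_single i₀]
        · simp [lo, hi]
        · intro i _ hi'
          simp only [lo, hi, Function.update_of_ne hi']
          norm_num
        · simp

theorem ofReal_pow_mul_volume_ball_le_two_mul {d : ℕ} (v q : EuclideanSpace ℝ (Fin d)) {ρ : ℝ}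
    (hρ : 0 < ρ) :
    ENNReal.ofReal (ρ ^ d) * volume (ball (0 : EuclideanSpace ℝ (Fin d)) 1) ≤
      2 * volume {z | z ∈ ball q ρ ∧ 0 ≤ ⟪v, z - q⟫_ℝ} := by
  set H := {z | z ∈ ball q ρ ∧ 0 ≤ ⟪v, z - q⟫_ℝ}
  have hHm : MeasurableSet H := by
    have hf : Measurable fun z : EuclideanSpace ℝ (Fin d) => ⟪v, z - q⟫_ℝ :=
      (continuous_const.inner (continuous_id.sub continuous_const)).measurable
    exact measurableSet_ball.inter (measurableSet_le measurable_const hf)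
  have hball : volume (ball q ρ) =
      ENNReal.ofReal (ρ ^ d) * volume (ball (0 : EuclideanSpace ℝ (Fin d)) 1) := by
    rw [Measure.addHaar_ball_of_pos _ _ hρ]
    simp
  have hmp := Measure.measurePreserving_sub_left
    (volume : Measure (EuclideanSpace ℝ (Fin d))) ((2 : ℝ) • q)
  have hcover : ball q ρ ⊆ H ∪ (fun z => (2 : ℝ) • q - z) ⁻¹' H := by
    intro z hz
    have hrefl : (2 : ℝ) • q - z - q = -(z - q) := by rw [two_smul]; abel
    rcases le_total 0 ⟪v, z - q⟫_ℝ with h | h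
    · exact Or.inl ⟨hz, h⟩
    · refine Or.inr ⟨?_, ?_⟩
      · rw [mem_ball, dist_eq_norm, hrefl, norm_neg, ← dist_eq_norm]
        exact hz
      · rw [hrefl, inner_neg_right]
        linarith
  calc _ = volume (ball q ρ) := hball.symm
    _ ≤ volume (H ∪ (fun z => (2 : ℝ) • q - z) ⁻¹' H) := measure_mono hcover
    _ ≤ volume H + volume ((fun z => (2 : ℝ) • q - z) ⁻¹' H) := measure_union_le _ _
    _ = 2 * volume H := by
      rw [hmp.measure_preimage hHm.nullMeasurableSet, two_mul]

theorem cross_ratio_smul {d : ℕ} {q : EuclideanSpace ℝ (Fin d)} (hq : q ≠ 0) {s t : ℝ}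
    (ht : t < 0) (hs : 1 < s) :
    (‖q - t • q‖ * ‖0 - s • q‖) / (‖0 - t • q‖ * ‖q - s • q‖) =
      (1 - t) * s / (-t * (s - 1)) := by
  have hn : ‖q‖ ≠ 0 := norm_ne_zero_iff.2 hq
  have e1 : q - t • q = (1 - t) • q := by rw [sub_smul, one_smul]
  have e2 : q - s • q = (1 - s) • q := by rw [sub_smul, one_smul]
  rw [e1, e2, zero_sub, zero_sub, norm_neg, norm_neg, norm_smul, norm_smul, norm_smul, norm_smul,
    Real.norm_of_nonneg (by linarith : 0 ≤ 1 - t), Real.norm_of_nonneg (by linarith : 0 ≤ s),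
    Real.norm_of_nonpos ht.le, Real.norm_of_nonpos (by linarith : 1 - s ≤ 0)]
  have : s - 1 ≠ 0 := by linarith
  have : t ≠ 0 := ht.ne
  have : 1 - s ≠ 0 := by linarith
  field_simp
  ring

theorem one_le_cross_ratio {s t : ℝ} (ht : t < 0) (hs : 1 < s) :
    1 ≤ (1 - t) * s / (-t * (s - 1)) := by
  rw [le_div_iff₀ (mul_pos (by linarith) (by linarith))]
  nlinarith

theorem exists_smul_mem_frontier {d : ℕ} {K : Set (EuclideanSpace ℝ (Fin d))}
    (hopen : IsOpen K) (hbdd : IsBounded K) (hconv : Convex ℝ K) (h0 : 0 ∈ K)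
    {q : EuclideanSpace ℝ (Fin d)} (hq : q ≠ 0) :
    ∃ s : ℝ, 0 < s ∧ (q ∈ K → 1 < s) ∧ s • q ∈ frontier K := by
  have hnhds : K ∈ nhds (0 : EuclideanSpace ℝ (Fin d)) := hopen.mem_nhds h0
  have hpos : 0 < gauge K q :=
    (gauge_pos (absorbent_nhds_zero hnhds) (NormedSpace.isVonNBounded_of_isBounded ℝ hbdd)).2 hq
  refine ⟨(gauge K q)⁻¹, inv_pos.2 hpos, fun hqK => ?_, ?_⟩
  · exact (one_lt_inv₀ hpos).2 (gauge_lt_one_of_mem_of_isOpen hopen hqK)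
  · rw [← gauge_eq_one_iff_mem_frontier hconv hnhds,
      gauge_smul_of_nonneg (inv_nonneg.2 hpos.le), smul_eq_mul, inv_mul_cancel₀ hpos.ne']

theorem hilbertDist_zero_left_eq {d : ℕ} (K : Set (EuclideanSpace ℝ (Fin d)))
    {q : EuclideanSpace ℝ (Fin d)} (hq : q ≠ 0) :
    hilbertDist K 0 q = sInf {r : ℝ | ∃ t s : ℝ, t < 0 ∧ 1 < s ∧ t • q ∈ frontier K ∧
      s • q ∈ frontier K ∧ r = 1 / 2 * Real.log ((1 - t) * s / (-t * (s - 1)))} := by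
  unfold hilbertDist
  congr 1
  ext r
  constructor
  · rintro (⟨h, _⟩ | ⟨a, b, ha, hb, ⟨t, ht, rfl⟩, ⟨s, hs, rfl⟩, rfl⟩)
    · exact absurd h.symm hq
    · simp only [sub_zero, zero_add] at ha hb ⊢
      refine ⟨t, s, ht, hs, ha, hb, ?_⟩
      rw [← cross_ratio_smul hq ht hs]
  · rintro ⟨t, s, ht, hs, ha, hb, rfl⟩
    refine Or.inr ⟨t • q, s • q, ha, hb, ⟨t, ht, by simp⟩, ⟨s, hs, by simp⟩, ?_⟩
    rw [cross_ratio_smul hq ht hs]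

theorem hilbertDist_zero_zero {d : ℕ} {K : Set (EuclideanSpace ℝ (Fin d))} (hopen : IsOpen K)
    (h0 : 0 ∈ K) : hilbertDist K 0 0 = 0 := by
  have hfr : (0 : EuclideanSpace ℝ (Fin d)) ∉ frontier K := fun h =>
    (hopen.frontier_eq ▸ h).2 h0
  have : {r : ℝ | ((0 : EuclideanSpace ℝ (Fin d)) = 0 ∧ r = 0) ∨
    ∃ a b : EuclideanSpace ℝ (Fin d), a ∈ frontier K ∧ b ∈ frontier K ∧
      (∃ t : ℝ, t < 0 ∧ a = 0 + t • ((0 : EuclideanSpace ℝ (Fin d)) - 0)) ∧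
      (∃ s : ℝ, 1 < s ∧ b = 0 + s • ((0 : EuclideanSpace ℝ (Fin d)) - 0)) ∧
      r = (1 / 2) * Real.log ((‖0 - a‖ * ‖0 - b‖) / (‖0 - a‖ * ‖0 - b‖))} = {0} := by
    ext r
    constructor
    · rintro (⟨_, h⟩ | ⟨a, b, ha, _, ⟨t, _, rfl⟩, _⟩)
      · exact h
      · simp [hfr] at ha
    · intro h
      exact Or.inl ⟨rfl, h⟩
  unfold hilbertDist
  rw [this, csInf_singleton]

theorem mem_of_mem_depthRegion {d : ℕ} {K : Set (EuclideanSpace ℝ (Fin d))}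
    (hne : K.Nonempty) (hopen : IsOpen K) (hconv : Convex ℝ K) {δ : ℝ} (hδ : 0 < δ)
    {q : EuclideanSpace ℝ (Fin d)} (hq : q ∈ depthRegion K δ) : q ∈ K := by
  by_contra hqK
  obtain ⟨v, hv, hlt⟩ := exists_unit_inner_lt_of_notMem hne hopen hconv hqK
  have h := (show δ ≤ halfspaceDepth K q from hq).trans
    (ciInf_le (bddBelow_halfspaceFractions K q) ⟨v, hv⟩)
  have hempty : {z | z ∈ K ∧ 0 ≤ ⟪v, z - q⟫_ℝ} = ∅ := by
    refine Set.eq_empty_of_forall_notMem ?_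
    rintro z ⟨hz, hz'⟩
    rw [inner_sub_right] at hz'
    linarith [hlt z hz]
  simp only [hempty, measure_empty, ENNReal.toReal_zero, zero_div] at h
  linarith

theorem ball_subset_of_smul_mem_closure {d : ℕ} {K : Set (EuclideanSpace ℝ (Fin d))}
    (hopen : IsOpen K) (hconv : Convex ℝ K) {γ s : ℝ}
    (hγK : ball (0 : EuclideanSpace ℝ (Fin d)) γ ⊆ K) (hs : 1 < s)
    {q : EuclideanSpace ℝ (Fin d)} (hb : s • q ∈ closure K) :
    ball q ((s - 1) / s * γ) ⊆ K := by
  intro z hz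
  have hs0 : 0 < s := by linarith
  have hl : 0 < (s - 1) / s := div_pos (by linarith) hs0
  set w := ((s - 1) / s)⁻¹ • (z - q) with hw
  have hwK : w ∈ K := by
    apply hγK
    rw [mem_ball_zero_iff, hw, norm_smul, norm_inv, Real.norm_of_nonneg hl.le,
      inv_mul_lt_iff₀ hl, ← dist_eq_norm]
    exact hz
  have hz' : z = ((s - 1) / s) • w + s⁻¹ • (s • q) := by
    rw [hw, smul_inv_smul₀ hl.ne', inv_smul_smul₀ hs0.ne']
    abel
  rw [hz']
  apply interior_subset
  refine hconv.combo_interior_closure_mem_interior ?_ hb hl (inv_nonneg.2 hs0.le) ?_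
  · rwa [hopen.interior_eq]
  · field_simp
    ring

theorem le_halfspaceDepth_of_ball_subset {d : ℕ} (hd : 1 ≤ d)
    {K : Set (EuclideanSpace ℝ (Fin d))} (hbdd : IsBounded K)
    {q : EuclideanSpace ℝ (Fin d)} {ρ : ℝ} (hρ : 0 < ρ) (hball : ball q ρ ⊆ K) :
    ρ ^ d * omegaBall d / 2 / (volume K).toReal ≤ halfspaceDepth K q := by
  have : Nonempty {v : EuclideanSpace ℝ (Fin d) // ‖v‖ = 1} :=
    ⟨⟨EuclideanSpace.single ⟨0, hd⟩ 1, by simp⟩⟩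
  refine le_ciInf fun v => ?_
  gcongr
  have hsub : {z | z ∈ ball q ρ ∧ 0 ≤ ⟪(v : EuclideanSpace ℝ (Fin d)), z - q⟫_ℝ} ⊆
      {z | z ∈ K ∧ 0 ≤ ⟪(v : EuclideanSpace ℝ (Fin d)), z - q⟫_ℝ} :=
    fun z hz => ⟨hball hz.1, hz.2⟩
  have hfin : volume {z | z ∈ K ∧ 0 ≤ ⟪(v : EuclideanSpace ℝ (Fin d)), z - q⟫_ℝ} ≠ ⊤ :=
    ((measure_mono fun z hz => hz.1).trans_lt hbdd.measure_lt_top).ne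
  have h := (ofReal_pow_mul_volume_ball_le_two_mul (v : EuclideanSpace ℝ (Fin d)) q hρ).trans
    (mul_le_mul_right (measure_mono hsub) 2)
  have h' := ENNReal.toReal_mono (ENNReal.mul_ne_top (by simp) hfin) h
  rw [ENNReal.toReal_mul, ENNReal.toReal_mul, ENNReal.toReal_ofReal (by positivity)] at h'
  simp only [ENNReal.toReal_ofNat] at h'
  unfold omegaBall
  linarith

theorem halfspaceDepth_mul_volume_le {d : ℕ} {K : Set (EuclideanSpace ℝ (Fin d))}
    (hne : K.Nonempty) (hopen : IsOpen K) (hbdd : IsBounded K) (hconv : Convex ℝ K)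
    (hK12 : K ⊆ ball (0 : EuclideanSpace ℝ (Fin d)) (1 / 2))
    {q : EuclideanSpace ℝ (Fin d)} {s : ℝ} (hs : 1 < s) (hb : s • q ∈ frontier K) :
    halfspaceDepth K q * (volume K).toReal ≤ (s - 1) / s / 2 := by
  have hs0 : 0 < s := by linarith
  have hl : 0 < (s - 1) / s := div_pos (by linarith) hs0
  have hV : 0 < (volume K).toReal :=
    ENNReal.toReal_pos (hopen.measure_pos volume hne).ne' hbdd.measure_lt_top.ne
  obtain ⟨v, hv, hlt⟩ := exists_unit_inner_lt_of_notMem hne hopen hconv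
    (hopen.frontier_eq ▸ hb).2
  have hbn : ‖s • q‖ ≤ 1 / 2 := by
    have := closure_ball_subset_closedBall (closure_mono hK12 (frontier_subset_closure hb))
    simpa using this
  have hh : ⟪v, s • q⟫_ℝ ≤ 1 / 2 :=
    (real_inner_le_norm _ _).trans (by rw [hv, one_mul]; exact hbn)
  have hvq : ⟪v, q⟫_ℝ = ⟪v, s • q⟫_ℝ / s := by
    rw [real_inner_smul_right]
    field_simp
  have hcap := volume_le_of_subset_slab (S := {z | z ∈ K ∧ 0 ≤ ⟪v, z - q⟫_ℝ}) hv
    (c := ⟪v, q⟫_ℝ) (e := ⟪v, s • q⟫_ℝ)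
    (fun z hz => (mem_ball_zero_iff.1 (hK12 hz.1)).le)
    (fun z hz => ⟨by have := hz.2; rw [inner_sub_right] at this; linarith, (hlt z hz.1).le⟩)
  have hwidth : ⟪v, s • q⟫_ℝ - ⟪v, q⟫_ℝ ≤ (s - 1) / s / 2 := by
    have : ⟪v, s • q⟫_ℝ - ⟪v, q⟫_ℝ = (s - 1) / s * ⟪v, s • q⟫_ℝ := by
      rw [hvq]
      field_simp
    rw [this]
    nlinarith
  have hcap' : (volume {z | z ∈ K ∧ 0 ≤ ⟪v, z - q⟫_ℝ}).toReal ≤ (s - 1) / s / 2 :=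
    ENNReal.toReal_le_of_le_ofReal (by positivity)
      (hcap.trans (ENNReal.ofReal_le_ofReal hwidth))
  have hD := ciInf_le (bddBelow_halfspaceFractions K q) ⟨v, hv⟩
  exact ((le_div_iff₀ hV).1 hD).trans hcap'

theorem omegaBall_pos (d : ℕ) : 0 < omegaBall d :=
  ENNReal.toReal_pos (measure_ball_pos volume _ one_pos).ne' measure_ball_lt_top.ne

theorem stmt0 {d : ℕ} (hd : 1 ≤ d) (K : Set (EuclideanSpace ℝ (Fin d)))
    (hKne : K.Nonempty) (hKopen : IsOpen K) (hKbdd : IsBounded K) (hKconv : Convex ℝ K)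
    (γ : ℝ) (hγ0 : 0 < γ) (hγ1 : γ ≤ 1 / 2)
    (hγK : ball (0 : EuclideanSpace ℝ (Fin d)) γ ⊆ K)
    (hK12 : K ⊆ ball (0 : EuclideanSpace ℝ (Fin d)) (1 / 2))
    (δ : ℝ) (hδ0 : 0 < δ) (hδ1 : δ ≤ 1 / 2)
    (ho : (0 : EuclideanSpace ℝ (Fin d)) ∈ depthRegion K δ) :
    hilbertBall K 0 ((1 / (2 * d)) * Real.log (1 / δ)
        + (1 / (2 * d)) * Real.log (2 ^ (2 * d - 1) * γ ^ (3 * d) * omegaBall d / (volume K).toReal))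
      ⊆ depthRegion K δ ∧
    depthRegion K δ ⊆
      hilbertBall K 0 ((1 / 2) * Real.log (1 / δ)
        + (1 / 2) * Real.log (d * (1 + 2 * γ) / (4 * Real.sqrt 3 * γ ^ 2 * (volume K).toReal))) := by
  have h0 : (0 : EuclideanSpace ℝ (Fin d)) ∈ K := hγK (mem_ball_self hγ0)
  have hV : 0 < (volume K).toReal :=
    ENNReal.toReal_pos (hKopen.measure_pos volume hKne).ne' hKbdd.measure_lt_top.ne
  have hω := omegaBall_pos d
  have hdpos : (0 : ℝ) < d := by exact_mod_cast hd
  set V := (volume K).toReal with hVdef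
  have hline : ∀ q ∈ K, q ≠ 0 →
      ∃ t s : ℝ, t < 0 ∧ 1 < s ∧ t • q ∈ frontier K ∧ s • q ∈ frontier K := by
    intro q hqK hq
    obtain ⟨s, -, hs, hsb⟩ := exists_smul_mem_frontier hKopen hKbdd hKconv h0 hq
    obtain ⟨u, hu, -, hub⟩ :=
      exists_smul_mem_frontier hKopen hKbdd hKconv h0 (neg_ne_zero.2 hq)
    exact ⟨-u, s, neg_lt_zero.2 hu, hs hqK, by rwa [neg_smul, ← smul_neg], hsb⟩
  constructor
  · rintro q ⟨-, hqK, hlt⟩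
    rcases eq_or_ne q 0 with rfl | hq
    · exact ho
    rw [hilbertDist_zero_left_eq K hq] at hlt
    obtain ⟨t₀, s₀, h1, h2, h3, h4⟩ := hline q hqK hq
    obtain ⟨r, ⟨t, s, ht, hs, -, hsb, rfl⟩, hr⟩ :=
      exists_lt_of_csInf_lt (by exact ⟨_, t₀, s₀, h1, h2, h3, h4, rfl⟩) hlt
    have hs0 : 0 < s := by linarith
    have hl : 0 < (s - 1) / s := div_pos (by linarith) hs0
    have hinv : ((s - 1) / s)⁻¹ ≤ (1 - t) * s / (-t * (s - 1)) := by
      rw [inv_div, div_le_div_iff₀ (by linarith) (mul_pos (by linarith) (by linarith))]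
      nlinarith [mul_pos hs0 (sub_pos.2 hs)]
    have hlog := Real.log_le_log (inv_pos.2 hl) hinv
    have hpow : (((s - 1) / s)⁻¹) ^ d ≤
        1 / δ * (2 ^ (2 * d - 1) * γ ^ (3 * d) * omegaBall d / V) := by
      rw [← Real.log_le_log_iff (by positivity) (by positivity), Real.log_pow,
        Real.log_mul (by positivity) (by positivity)]
      have hr' : 1 / 2 * Real.log (((s - 1) / s)⁻¹) < 1 / (2 * d) * (Real.log (1 / δ) +
          Real.log (2 ^ (2 * d - 1) * γ ^ (3 * d) * omegaBall d / V)) := by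
        rw [mul_add]
        linarith
      have e := mul_lt_mul_of_pos_left hr' (by positivity : (0 : ℝ) < 2 * d)
      rw [← mul_assoc, ← mul_assoc, mul_one_div_cancel (by positivity), one_mul] at e
      linarith
    have hdepth := le_halfspaceDepth_of_ball_subset hd hKbdd (mul_pos hl hγ0)
      (ball_subset_of_smul_mem_closure hKopen hKconv hγK hs (frontier_subset_closure hsb))
    refine le_trans ?_ hdepth
    rw [← hVdef, mul_pow]
    set L := ((s - 1) / s) ^ d with hL
    have hLpos : 0 < L := pow_pos hl d
    rw [inv_pow, ← hL] at hpow
    have htwo : (2 : ℝ) ^ (2 * d) = 2 ^ (2 * d - 1) * 2 := by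
      rw [← pow_succ]
      congr 1
      omega
    have hsmall : (2 : ℝ) ^ (2 * d) * γ ^ (2 * d) ≤ 1 := by
      rw [← mul_pow]
      exact pow_le_one₀ (by positivity) (by linarith)
    have hγd : γ ^ (3 * d) = γ ^ (2 * d) * γ ^ d := by rw [← pow_add]; congr 1; ring
    rw [inv_le_iff_one_le_mul₀ hLpos] at hpow
    have hbound : δ * V ≤ L * (2 ^ (2 * d - 1) * γ ^ (3 * d) * omegaBall d) := by
      have : L * (2 ^ (2 * d - 1) * γ ^ (3 * d) * omegaBall d) =
          (1 / δ * (2 ^ (2 * d - 1) * γ ^ (3 * d) * omegaBall d / V) * L) * (δ * V) := by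
        field_simp
      rw [this]
      exact le_mul_of_one_le_left (by positivity) (by linarith)
    rw [le_div_iff₀ hV]
    refine hbound.trans ?_
    calc L * (2 ^ (2 * d - 1) * γ ^ (3 * d) * omegaBall d)
        = (2 ^ (2 * d) * γ ^ (2 * d)) * (L * γ ^ d * omegaBall d / 2) := by
          rw [htwo, hγd]; ring
      _ ≤ L * γ ^ d * omegaBall d / 2 := mul_le_of_le_one_left (by positivity) hsmall
  · intro q hq
    have hqK := mem_of_mem_depthRegion hKne hKopen hKconv hδ0 hq
    rw [← mul_add, ← Real.log_mul (by positivity) (by positivity)]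
    have h3 : Real.sqrt 3 < 2 := by
      rw [Real.sqrt_lt' (by norm_num)]
      norm_num
    have hγd : Real.sqrt 3 * γ < d := by
      have : (1 : ℝ) ≤ d := by exact_mod_cast hd
      nlinarith [Real.sqrt_nonneg 3]
    have hgap : (1 + 2 * γ) / (4 * γ * (δ * V)) <
        1 / δ * (d * (1 + 2 * γ) / (4 * Real.sqrt 3 * γ ^ 2 * V)) := by
      have e : (1 + 2 * γ) / (4 * γ * (δ * V)) =
          1 / δ * (Real.sqrt 3 * γ * (1 + 2 * γ) / (4 * Real.sqrt 3 * γ ^ 2 * V)) := by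
        field_simp
      rw [e]
      gcongr
    rcases eq_or_ne q 0 with rfl | hq0
    · have hV1 : δ * V ≤ 1 / 2 := by
        have hV2 : V ≤ 1 := by
          have hv : ‖EuclideanSpace.single (⟨0, hd⟩ : Fin d) (1 : ℝ)‖ = 1 := by simp
          have hin : ∀ z ∈ K, |⟪EuclideanSpace.single (⟨0, hd⟩ : Fin d) (1 : ℝ), z⟫_ℝ| ≤ 1 / 2 :=
            fun z hz => (abs_real_inner_le_norm _ _).trans
              (by rw [hv, one_mul]; exact (mem_ball_zero_iff.1 (hK12 hz)).le)
          have := volume_le_of_subset_slab (S := K) hv (c := -(1 / 2)) (e := 1 / 2)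
            (fun z hz => (mem_ball_zero_iff.1 (hK12 hz)).le) (fun z hz => abs_le.1 (hin z hz))
          exact ENNReal.toReal_le_of_le_ofReal (by norm_num)
            (this.trans (ENNReal.ofReal_le_ofReal (by norm_num)))
        nlinarith
      have hone : 1 ≤ (1 + 2 * γ) / (4 * γ * (δ * V)) := by
        rw [le_div_iff₀ (by positivity)]
        nlinarith
      have hpos := Real.log_pos (hone.trans_lt hgap)
      refine ⟨by positivity, hqK, ?_⟩
      rw [hilbertDist_zero_zero hKopen h0]
      positivity
    · obtain ⟨t, s, ht, hs, hta, hsb⟩ := hline q hqK hq0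
      have hs0 : 0 < s := by linarith
      have hcap := halfspaceDepth_mul_volume_le hKne hKopen hKbdd hKconv hK12 hs hsb
      have hδV : δ * V ≤ (s - 1) / s / 2 :=
        (mul_le_mul_of_nonneg_right hq hV.le).trans hcap
      have htγ : 2 * γ ≤ -t := by
        have h1 : γ ≤ ‖t • q‖ := by
          by_contra! h
          exact (hKopen.frontier_eq ▸ hta).2 (hγK (mem_ball_zero_iff.2 h))
        rw [norm_smul, Real.norm_of_nonpos ht.le] at h1
        have h2 : ‖q‖ < 1 / 2 := mem_ball_zero_iff.1 (hK12 hqK)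
        nlinarith
      have hratio : (1 - t) * s / (-t * (s - 1)) ≤ (1 + 2 * γ) / (4 * γ * (δ * V)) := by
        have e1 : (1 - t) / -t ≤ (1 + 2 * γ) / (2 * γ) := by
          rw [div_le_div_iff₀ (by linarith) (by positivity)]
          nlinarith
        have e2 : s / (s - 1) ≤ 1 / (2 * (δ * V)) := by
          rw [div_div, le_div_iff₀ (by positivity)] at hδV
          rw [div_le_div_iff₀ (by linarith) (by positivity)]
          linarith
        calc (1 - t) * s / (-t * (s - 1)) = (1 - t) / -t * (s / (s - 1)) :=
              (div_mul_div_comm _ _ _ _).symm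
          _ ≤ (1 + 2 * γ) / (2 * γ) * (1 / (2 * (δ * V))) :=
              mul_le_mul e1 e2 (div_nonneg hs0.le (by linarith)) (by positivity)
          _ = (1 + 2 * γ) / (4 * γ * (δ * V)) := by
              field_simp
              norm_num
      have hcr := one_le_cross_ratio ht hs
      have hlog := Real.log_lt_log (by linarith) (hratio.trans_lt hgap)
      have hlog0 := Real.log_nonneg hcr
      refine ⟨by linarith, hqK, ?_⟩
      rw [hilbertDist_zero_left_eq K hq0]
      refine lt_of_le_of_lt (csInf_le ⟨0, ?_⟩ ⟨t, s, ht, hs, hta, hsb, rfl⟩) (by linarith)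
      rintro _ ⟨t', s', ht', hs', -, -, rfl⟩
      have := Real.log_nonneg (one_le_cross_ratio ht' hs')
      positivity
end

section
/- Let d ≥ 1, let K ⊂ ℝ^d be an open convex body with B(o,1/(2d)) ⊂ K ⊂ B(o,1/2), and let δ ∈ (0,1/2] be such that K_δ ≠ ∅. Then there exists x_δ ∈ K_δ such that K_δ ⊆ B_K(x_δ, (1/2)·ln(1/δ) + 24d³). Moreover, if o ∈ K_δ then x_δ = o works, and if o ∉ K_δ then every point x_δ ∈ K_δ works. -/
open MeasureTheory Metric Bornology
open scoped InnerProductSpace Pointwise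

theorem exists_unit_inner_lt {d : ℕ} {K : Set (EuclideanSpace ℝ (Fin d))}
    (hKne : K.Nonempty) (hKopen : IsOpen K) (hKconv : Convex ℝ K)
    {b : EuclideanSpace ℝ (Fin d)} (hb : b ∉ K) :
    ∃ v : EuclideanSpace ℝ (Fin d), ‖v‖ = 1 ∧ ∀ z ∈ K, ⟪v, z⟫_ℝ < ⟪v, b⟫_ℝ := by
  obtain ⟨f, hf⟩ := geometric_hahn_banach_open_point hKconv hKopen hb
  set u := (InnerProductSpace.toDual ℝ (EuclideanSpace ℝ (Fin d))).symm f with hu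
  have hfu : ∀ z, f z = ⟪u, z⟫_ℝ := fun z => by
    rw [hu, InnerProductSpace.toDual_symm_apply]
  have hu0 : u ≠ 0 := by
    intro h
    obtain ⟨z, hz⟩ := hKne
    have := hf z hz
    simp [hfu, h] at this
  have hpos : 0 < ‖u‖ := norm_pos_iff.2 hu0
  refine ⟨‖u‖⁻¹ • u, by rw [norm_smul, norm_inv, norm_norm, inv_mul_cancel₀ hpos.ne'], ?_⟩
  intro z hz
  rw [real_inner_smul_left, real_inner_smul_left, ← hfu, ← hfu]
  exact mul_lt_mul_of_pos_left (hf z hz) (inv_pos.2 hpos)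

theorem halfspaceDepth_le {d : ℕ} (K : Set (EuclideanSpace ℝ (Fin d)))
    (q v : EuclideanSpace ℝ (Fin d)) (hv : ‖v‖ = 1) :
    halfspaceDepth K q ≤
      (volume {z : EuclideanSpace ℝ (Fin d) | z ∈ K ∧ 0 ≤ ⟪v, z - q⟫_ℝ}).toReal
        / (volume K).toReal :=
  ciInf_le (f := fun v : {v : EuclideanSpace ℝ (Fin d) // ‖v‖ = 1} =>
    (volume {z : EuclideanSpace ℝ (Fin d) |
      z ∈ K ∧ 0 ≤ ⟪(v : EuclideanSpace ℝ (Fin d)), z - q⟫_ℝ}).toReal / (volume K).toReal)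
    ⟨0, by rintro _ ⟨w, rfl⟩; positivity⟩ ⟨v, hv⟩

theorem depthRegion_subset {d : ℕ} {K : Set (EuclideanSpace ℝ (Fin d))}
    (hKne : K.Nonempty) (hKopen : IsOpen K) (hKconv : Convex ℝ K) {δ : ℝ} (hδ : 0 < δ) :
    depthRegion K δ ⊆ K := by
  intro q hq
  by_contra hqK
  obtain ⟨v, hv, hlt⟩ := exists_unit_inner_lt hKne hKopen hKconv hqK
  have hempty : {z : EuclideanSpace ℝ (Fin d) | z ∈ K ∧ 0 ≤ ⟪v, z - q⟫_ℝ} = ∅ := by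
    ext z
    simp only [Set.mem_ofPred_eq, Set.mem_empty_iff_false, iff_false, not_and, not_le]
    intro hz
    rw [inner_sub_right]
    linarith [hlt z hz]
  have h1 : δ ≤ halfspaceDepth K q := hq
  have h2 := halfspaceDepth_le K q v hv
  rw [hempty] at h2
  simp at h2
  linarith

theorem measurableSet_inter_halfspace {d : ℕ} {K : Set (EuclideanSpace ℝ (Fin d))}
    (hK : MeasurableSet K) (v q : EuclideanSpace ℝ (Fin d)) :
    MeasurableSet {z : EuclideanSpace ℝ (Fin d) | z ∈ K ∧ 0 ≤ ⟪v, z - q⟫_ℝ} :=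
  hK.inter (isClosed_le (f := fun _ => (0 : ℝ)) (g := fun z => ⟪v, z - q⟫_ℝ)
    continuous_const (by fun_prop)).measurableSet

/-- A slab of width `w` inside a ball of radius `1 / 2` has volume at most `w` times that of the
ball of radius `3 / 2`, since about `1 / w` disjoint translates of it fit there. -/
theorem volume_slab_le {d : ℕ} {S : Set (EuclideanSpace ℝ (Fin d))} (hS : MeasurableSet S)
    (hball : S ⊆ ball 0 (1 / 2)) {v : EuclideanSpace ℝ (Fin d)} (hv : ‖v‖ = 1) {c w : ℝ}
    (hw : 0 < w) (hslab : ∀ z ∈ S, c ≤ ⟪v, z⟫_ℝ ∧ ⟪v, z⟫_ℝ < c + w) :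
    volume.real S ≤ w * volume.real (ball (0 : EuclideanSpace ℝ (Fin d)) (3 / 2)) := by
  set N := ⌈1 / w⌉₊ with hN
  have hN1 : 1 / w ≤ N := Nat.le_ceil _
  have hN2 : (N : ℝ) < 1 / w + 1 := Nat.ceil_lt_add_one (by positivity)
  set T : ℕ → Set (EuclideanSpace ℝ (Fin d)) :=
    fun k => (fun z => z + (-((k : ℝ) * w)) • v) ⁻¹' S with hT
  have hvol : ∀ k, volume.real (T k) = volume.real S := fun k => by
    simp only [Measure.real, hT, measure_preimage_add_right]
  have hmeas : ∀ k, MeasurableSet (T k) := fun k => hS.preimage (by fun_prop)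
  have hvv : ⟪v, v⟫_ℝ = 1 := by rw [real_inner_self_eq_norm_sq, hv]; norm_num
  have hin : ∀ k, ∀ z ∈ T k, c + k * w ≤ ⟪v, z⟫_ℝ ∧ ⟪v, z⟫_ℝ < c + (k + 1) * w := by
    intro k z hz
    have := hslab _ hz
    rw [inner_add_right, real_inner_smul_right, hvv] at this
    constructor <;> linarith
  have hdisj : ∀ i j : ℕ, i < j → Disjoint (T i) (T j) := by
    intro i j hij
    rw [Set.disjoint_left]
    intro z hi hj
    have h1 := (hin i z hi).2
    have h2 := (hin j z hj).1
    have h3 : ((i : ℝ) + 1) * w ≤ j * w :=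
      mul_le_mul_of_nonneg_right (by exact_mod_cast hij) hw.le
    linarith
  have hpair : Set.PairwiseDisjoint (↑(Finset.range N)) T := by
    intro i _ j _ hij
    rcases lt_or_gt_of_ne hij with h | h
    · exact hdisj i j h
    · exact (hdisj j i h).symm
  have hsub : (⋃ k ∈ Finset.range N, T k) ⊆ ball (0 : EuclideanSpace ℝ (Fin d)) (3 / 2) := by
    intro z hz
    simp only [Set.mem_iUnion, Finset.mem_range] at hz
    obtain ⟨k, hk, hzk⟩ := hz
    have h1 := hball hzk
    rw [mem_ball_zero_iff] at h1 ⊢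
    have hkN : (k : ℝ) + 1 ≤ N := by exact_mod_cast hk
    have hkw : (k : ℝ) * w ≤ 1 := by
      have : (k : ℝ) ≤ 1 / w := by linarith
      rwa [le_div_iff₀ hw] at this
    have hnorm : ‖((k : ℝ) * w) • v‖ ≤ 1 := by
      rw [norm_smul, hv, mul_one, Real.norm_of_nonneg (by positivity)]
      exact hkw
    calc ‖z‖ = ‖(z + (-((k : ℝ) * w)) • v) + ((k : ℝ) * w) • v‖ := by
          congr 1; module
      _ ≤ ‖z + (-((k : ℝ) * w)) • v‖ + ‖((k : ℝ) * w) • v‖ := norm_add_le _ _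
      _ < 3 / 2 := by linarith
  have hsum : (N : ℝ) * volume.real S ≤
      volume.real (ball (0 : EuclideanSpace ℝ (Fin d)) (3 / 2)) := by
    calc (N : ℝ) * volume.real S = ∑ k ∈ Finset.range N, volume.real (T k) := by
          simp [hvol]
      _ = volume.real (⋃ k ∈ Finset.range N, T k) :=
          (measureReal_biUnion_finset hpair (fun k _ => hmeas k)
            (fun k hk => ((measure_mono (Set.subset_biUnion_of_mem
              (u := T) (Finset.mem_coe.2 hk))).trans_lt
              ((measure_mono hsub).trans_lt measure_ball_lt_top)).ne)).symm
      _ ≤ _ := measureReal_mono hsub measure_ball_lt_top.ne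
  have h1 : 1 / w * volume.real S ≤ N * volume.real S :=
    mul_le_mul_of_nonneg_right hN1 measureReal_nonneg
  have h2 : 1 / w * volume.real S ≤ volume.real (ball (0 : EuclideanSpace ℝ (Fin d)) (3 / 2)) :=
    h1.trans hsum
  calc volume.real S = w * (1 / w * volume.real S) := by field_simp
    _ ≤ _ := mul_le_mul_of_nonneg_left h2 hw.le

theorem volumeReal_ball_mul {d : ℕ} {c : ℝ} (hc : 0 < c) (s : ℝ) :
    volume.real (ball (0 : EuclideanSpace ℝ (Fin d)) (c * s)) =
      c ^ d * volume.real (ball (0 : EuclideanSpace ℝ (Fin d)) s) := by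
  rw [Measure.real, Measure.addHaar_ball_mul_of_pos _ _ hc, finrank_euclideanSpace_fin,
    ENNReal.toReal_mul, ENNReal.toReal_ofReal (by positivity), Measure.real]

/-- Points of depth at least `δ` stay at distance `δ / (3 d) ^ d` from the boundary. -/
theorem le_dist_of_mem_depthRegion {d : ℕ} (hd : 1 ≤ d) {K : Set (EuclideanSpace ℝ (Fin d))}
    (hKopen : IsOpen K) (hKconv : Convex ℝ K)
    (hKin : ball (0 : EuclideanSpace ℝ (Fin d)) (1 / (2 * d)) ⊆ K)
    (hK12 : K ⊆ ball (0 : EuclideanSpace ℝ (Fin d)) (1 / 2))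
    {δ : ℝ} (hδ : 0 < δ) {y b : EuclideanSpace ℝ (Fin d)} (hy : y ∈ depthRegion K δ)
    (hb : b ∉ K) : δ / (3 * d) ^ d ≤ ‖y - b‖ := by
  have hd0 : (0 : ℝ) < d := by exact_mod_cast hd
  have hKne : K.Nonempty := ⟨0, hKin (mem_ball_self (by positivity))⟩
  have hyK := depthRegion_subset hKne hKopen hKconv hδ hy
  obtain ⟨v, hv, hlt⟩ := exists_unit_inner_lt hKne hKopen hKconv hb
  set S := {z : EuclideanSpace ℝ (Fin d) | z ∈ K ∧ 0 ≤ ⟪v, z - y⟫_ℝ} with hS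
  set w := ⟪v, b⟫_ℝ - ⟪v, y⟫_ℝ with hw
  have hw0 : 0 < w := sub_pos.2 (hlt y hyK)
  have hwle : w ≤ ‖y - b‖ := by
    rw [hw, ← inner_sub_right, norm_sub_rev]
    simpa [hv] using real_inner_le_norm v (b - y)
  have hslab := volume_slab_le (S := S) (measurableSet_inter_halfspace hKopen.measurableSet v y)
    (fun z hz => hK12 hz.1) hv (c := ⟪v, y⟫_ℝ) hw0 (by
      rintro z ⟨hz, hz'⟩
      rw [inner_sub_right] at hz'
      exact ⟨by linarith, by rw [hw]; linarith [hlt z hz]⟩)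
  have hKfin : volume K ≠ ⊤ := ((measure_mono hK12).trans_lt measure_ball_lt_top).ne
  have hbK : volume.real (ball (0 : EuclideanSpace ℝ (Fin d)) (1 / (2 * d))) ≤ volume.real K :=
    measureReal_mono hKin hKfin
  have hball : volume.real (ball (0 : EuclideanSpace ℝ (Fin d)) (3 / 2)) =
      (3 * d) ^ d * volume.real (ball (0 : EuclideanSpace ℝ (Fin d)) (1 / (2 * d))) := by
    rw [← volumeReal_ball_mul (by positivity)]
    congr 2
    field_simp
  have hbpos : 0 < volume.real (ball (0 : EuclideanSpace ℝ (Fin d)) (1 / (2 * d))) :=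
    ENNReal.toReal_pos (measure_ball_pos _ _ (by positivity)).ne' measure_ball_lt_top.ne
  have hKpos : 0 < volume.real K := hbpos.trans_le hbK
  have hdepth : δ ≤ volume.real S / volume.real K :=
    le_trans (show δ ≤ halfspaceDepth K y from hy) (halfspaceDepth_le K y v hv)
  rw [le_div_iff₀ hKpos] at hdepth
  have hmain : δ * volume.real K ≤ (w * (3 * d) ^ d) * volume.real K := by
    calc δ * volume.real K ≤ w * ((3 * d) ^ d *
          volume.real (ball (0 : EuclideanSpace ℝ (Fin d)) (1 / (2 * d)))) := by
          rw [← hball]; exact hdepth.trans hslab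
      _ ≤ w * ((3 * d) ^ d * volume.real K) := by gcongr
      _ = _ := by ring
  rw [div_le_iff₀ (by positivity)]
  exact (le_of_mul_le_mul_right hmain hKpos).trans (by gcongr)

theorem half_volume_ball_le {d : ℕ} (v : EuclideanSpace ℝ (Fin d)) (r : ℝ) :
    volume.real (ball (0 : EuclideanSpace ℝ (Fin d)) r) ≤
      2 * volume.real {z : EuclideanSpace ℝ (Fin d) | z ∈ ball 0 r ∧ 0 ≤ ⟪v, z - 0⟫_ℝ} := by
  set H := {z : EuclideanSpace ℝ (Fin d) | z ∈ ball 0 r ∧ 0 ≤ ⟪v, z - 0⟫_ℝ} with hH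
  have hHfin : volume H ≠ ⊤ :=
    ((measure_mono (fun z hz => hz.1)).trans_lt (measure_ball_lt_top (x := 0) (r := r))).ne
  have hneg : volume.real (-H) = volume.real H := by
    simp only [Measure.real, Measure.measure_neg]
  have hcover : ball (0 : EuclideanSpace ℝ (Fin d)) r ⊆ H ∪ -H := by
    intro z hz
    rcases le_total 0 ⟪v, z⟫_ℝ with h | h
    · exact Or.inl ⟨hz, by simpa using h⟩
    · refine Or.inr ⟨?_, ?_⟩
      · rw [mem_ball_zero_iff] at hz ⊢
        rwa [norm_neg]
      · rw [sub_zero, inner_neg_right]; linarith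
  calc volume.real (ball (0 : EuclideanSpace ℝ (Fin d)) r)
      ≤ volume.real (H ∪ -H) := measureReal_mono hcover
        (measure_union_lt_top hHfin.lt_top (by
          rw [Measure.measure_neg]; exact hHfin.lt_top)).ne
    _ ≤ volume.real H + volume.real (-H) := measureReal_union_le _ _
    _ = 2 * volume.real H := by rw [hneg]; ring

theorem le_halfspaceDepth_zero {d : ℕ} (hd : 1 ≤ d) {K : Set (EuclideanSpace ℝ (Fin d))}
    (hKin : ball (0 : EuclideanSpace ℝ (Fin d)) (1 / (2 * d)) ⊆ K)
    (hK12 : K ⊆ ball (0 : EuclideanSpace ℝ (Fin d)) (1 / 2)) :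
    1 / (2 * (d : ℝ) ^ d) ≤ halfspaceDepth K 0 := by
  have hd0 : (0 : ℝ) < d := by exact_mod_cast hd
  have hKfin : volume K ≠ ⊤ := ((measure_mono hK12).trans_lt measure_ball_lt_top).ne
  have hbK : volume.real (ball (0 : EuclideanSpace ℝ (Fin d)) (1 / (2 * d))) ≤ volume.real K :=
    measureReal_mono hKin hKfin
  have hbpos : 0 < volume.real (ball (0 : EuclideanSpace ℝ (Fin d)) (1 / (2 * d))) :=
    ENNReal.toReal_pos (measure_ball_pos _ _ (by positivity)).ne' measure_ball_lt_top.ne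
  have hKpos : 0 < volume.real K := hbpos.trans_le hbK
  have hKle : volume.real K ≤
      d ^ d * volume.real (ball (0 : EuclideanSpace ℝ (Fin d)) (1 / (2 * d))) := by
    rw [← volumeReal_ball_mul hd0]
    refine (measureReal_mono hK12 measure_ball_lt_top.ne).trans_eq ?_
    congr 2
    field_simp
  have : Nonempty {v : EuclideanSpace ℝ (Fin d) // ‖v‖ = 1} :=
    ⟨⟨EuclideanSpace.single ⟨0, hd⟩ 1, by simp⟩⟩
  refine le_ciInf fun v => ?_
  change _ ≤ volume.real {z : EuclideanSpace ℝ (Fin d) |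
    z ∈ K ∧ 0 ≤ ⟪(v : EuclideanSpace ℝ (Fin d)), z - 0⟫_ℝ} / volume.real K
  have h1 := half_volume_ball_le (v : EuclideanSpace ℝ (Fin d)) (1 / (2 * d))
  have h2 : volume.real {z : EuclideanSpace ℝ (Fin d) | z ∈ ball 0 (1 / (2 * (d : ℝ))) ∧
        0 ≤ ⟪(v : EuclideanSpace ℝ (Fin d)), z - 0⟫_ℝ} ≤
      volume.real {z : EuclideanSpace ℝ (Fin d) |
        z ∈ K ∧ 0 ≤ ⟪(v : EuclideanSpace ℝ (Fin d)), z - 0⟫_ℝ} :=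
    measureReal_mono (fun z hz => ⟨hKin hz.1, hz.2⟩)
      ((measure_mono (fun z hz => hz.1)).trans_lt hKfin.lt_top).ne
  rw [div_le_div_iff₀ (by positivity) hKpos, one_mul]
  calc volume.real K ≤ _ := hKle
    _ ≤ d ^ d * (2 * volume.real {z : EuclideanSpace ℝ (Fin d) |
          z ∈ K ∧ 0 ≤ ⟪(v : EuclideanSpace ℝ (Fin d)), z - 0⟫_ℝ}) :=
        mul_le_mul_of_nonneg_left (h1.trans (by linarith)) (by positivity)
    _ = _ := by ring

theorem exists_frontier_beyond {d : ℕ} {K : Set (EuclideanSpace ℝ (Fin d))}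
    (hKopen : IsOpen K) (hK12 : K ⊆ ball (0 : EuclideanSpace ℝ (Fin d)) (1 / 2))
    {p q : EuclideanSpace ℝ (Fin d)} (hq : q ∈ K) (hpq : p ≠ q) :
    ∃ s : ℝ, 1 < s ∧ p + s • (q - p) ∈ frontier K := by
  have hpos : 0 < ‖q - p‖ := norm_pos_iff.2 (sub_ne_zero.2 hpq.symm)
  set g : ℝ → EuclideanSpace ℝ (Fin d) := fun s => p + s • (q - p) with hg
  have hgc : Continuous g := by fun_prop
  have hg1 : g 1 = q := by simp [hg]
  obtain ⟨s₁, hs₁, hs₁'⟩ : ∃ s₁ : ℝ, 1 ≤ s₁ ∧ g s₁ ∉ K := by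
    refine ⟨1 + 1 / ‖q - p‖, by linarith [show 0 < 1 / ‖q - p‖ by positivity], fun h => ?_⟩
    have h1 := hK12 h
    have h2 := hK12 hq
    rw [mem_ball_zero_iff] at h1 h2
    have h3 : g (1 + 1 / ‖q - p‖) - q = (1 / ‖q - p‖) • (q - p) := by
      simp only [hg]; module
    have h4 : ‖g (1 + 1 / ‖q - p‖) - q‖ = 1 := by
      rw [h3, norm_smul, Real.norm_of_nonneg (by positivity)]
      field_simp
    linarith [norm_sub_le (g (1 + 1 / ‖q - p‖)) q]
  have hconn : IsPreconnected (g '' Set.Icc 1 s₁) := isPreconnected_Icc.image _ hgc.continuousOn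
  obtain ⟨s, hs, hfr⟩ : ∃ s ∈ Set.Icc 1 s₁, g s ∈ frontier K := by
    by_contra! hno
    refine hs₁' (hconn.subset_of_closure_inter_subset hKopen
      ⟨g 1, ⟨1, ⟨le_rfl, hs₁⟩, rfl⟩, hg1 ▸ hq⟩ ?_ ⟨s₁, ⟨hs₁, le_rfl⟩, rfl⟩)
    rintro _ ⟨hcl, s, hs, rfl⟩
    by_contra hsK
    exact hno s hs (by rw [hKopen.frontier_eq]; exact ⟨hcl, hsK⟩)
  refine ⟨s, lt_of_le_of_ne hs.1 ?_, hfr⟩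
  rintro rfl
  rw [hg1, hKopen.frontier_eq] at hfr
  exact hfr.2 hq

theorem hilbertDist_le {d : ℕ} {K : Set (EuclideanSpace ℝ (Fin d))}
    (hKopen : IsOpen K) (hK12 : K ⊆ ball (0 : EuclideanSpace ℝ (Fin d)) (1 / 2))
    {p q : EuclideanSpace ℝ (Fin d)} (hp : p ∈ K) (hq : q ∈ K) {r₁ r₂ : ℝ}
    (hr₁ : 0 < r₁) (hr₂ : 0 < r₂) (h₁ : ∀ b ∉ K, r₁ ≤ ‖p - b‖) (h₂ : ∀ b ∉ K, r₂ ≤ ‖q - b‖) :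
    hilbertDist K p q ≤ max 0 (1 / 2 * Real.log (1 / (r₁ * r₂))) := by
  unfold hilbertDist
  set A := {r : ℝ | (p = q ∧ r = 0) ∨
    ∃ a b : EuclideanSpace ℝ (Fin d), a ∈ frontier K ∧ b ∈ frontier K ∧
      (∃ t : ℝ, t < 0 ∧ a = p + t • (q - p)) ∧
      (∃ s : ℝ, 1 < s ∧ b = p + s • (q - p)) ∧
      r = (1 / 2) * Real.log ((‖q - a‖ * ‖p - b‖) / (‖p - a‖ * ‖q - b‖))} with hA
  by_cases hbdd : BddBelow A
  swap
  · rw [Real.sInf_of_not_bddBelow hbdd]; exact le_max_left _ _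
  by_cases hpq : p = q
  · exact (csInf_le hbdd (Or.inl ⟨hpq, rfl⟩)).trans (le_max_left _ _)
  obtain ⟨s, hs, hb⟩ := exists_frontier_beyond hKopen hK12 hq hpq
  obtain ⟨t, ht, ha⟩ := exists_frontier_beyond hKopen hK12 hp (Ne.symm hpq)
  have hae : q + t • (p - q) = p + (1 - t) • (q - p) := by module
  rw [hae] at ha
  refine (csInf_le hbdd (Or.inr ⟨_, _, ha, hb, ⟨1 - t, by linarith, rfl⟩, ⟨s, hs, rfl⟩, rfl⟩)).trans
    (le_trans ?_ (le_max_right _ _))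
  generalize p + (1 - t) • (q - p) = a at ha
  generalize p + s • (q - p) = b at hb
  have hout : ∀ {c}, c ∈ frontier K → c ∉ K := fun hc => by
    rw [hKopen.frontier_eq] at hc; exact hc.2
  have hnorm : ∀ {c x}, c ∈ frontier K → x ∈ K → ‖x - c‖ ≤ 1 := by
    intro c x hc hx
    have h1 : c ∈ closedBall (0 : EuclideanSpace ℝ (Fin d)) (1 / 2) :=
      closure_minimal (hK12.trans ball_subset_closedBall) isClosed_closedBall
        (frontier_subset_closure hc)
    have h2 := hK12 hx
    rw [mem_closedBall_zero_iff] at h1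
    rw [mem_ball_zero_iff] at h2
    linarith [norm_sub_le x c]
  have e1 := h₁ a (hout ha)
  have e2 := h₂ b (hout hb)
  have e3 := h₁ b (hout hb)
  have e4 := h₂ a (hout ha)
  have p1 : 0 < ‖p - a‖ := hr₁.trans_le e1
  have p2 : 0 < ‖q - b‖ := hr₂.trans_le e2
  have p3 : 0 < ‖p - b‖ := hr₁.trans_le e3
  have p4 : 0 < ‖q - a‖ := hr₂.trans_le e4
  have m1 := hnorm ha hq
  have m2 := hnorm hb hp
  gcongr
  exact mul_le_one₀ m1 p3.le m2

theorem mem_hilbertBall_of_dist {d : ℕ} {K : Set (EuclideanSpace ℝ (Fin d))}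
    (hKopen : IsOpen K) (hK12 : K ⊆ ball (0 : EuclideanSpace ℝ (Fin d)) (1 / 2))
    {p q : EuclideanSpace ℝ (Fin d)} (hp : p ∈ K) (hq : q ∈ K) {r₁ r₂ R : ℝ}
    (hr₁ : 0 < r₁) (hr₂ : 0 < r₂) (h₁ : ∀ b ∉ K, r₁ ≤ ‖p - b‖) (h₂ : ∀ b ∉ K, r₂ ≤ ‖q - b‖)
    (hR : 0 < R) (hlt : 1 / 2 * Real.log (1 / (r₁ * r₂)) < R) : q ∈ hilbertBall K p R :=
  ⟨hR, hq, (hilbertDist_le hKopen hK12 hp hq hr₁ hr₂ h₁ h₂).trans_lt (max_lt hR hlt)⟩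

theorem depthRegion_subset_hilbertBall_zero {d : ℕ} (hd : 1 ≤ d)
    {K : Set (EuclideanSpace ℝ (Fin d))} (hKopen : IsOpen K) (hKconv : Convex ℝ K)
    (hKin : ball (0 : EuclideanSpace ℝ (Fin d)) (1 / (2 * d)) ⊆ K)
    (hK12 : K ⊆ ball (0 : EuclideanSpace ℝ (Fin d)) (1 / 2))
    {δ : ℝ} (hδ0 : 0 < δ) (hδ1 : δ ≤ 1 / 2) :
    depthRegion K δ ⊆ hilbertBall K 0 ((1 / 2) * Real.log (1 / δ) + 24 * d ^ 3) := by
  intro y hy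
  have hd1 : (1 : ℝ) ≤ d := by exact_mod_cast hd
  have hd0 : (0 : ℝ) < d := by linarith
  have h0 : (0 : EuclideanSpace ℝ (Fin d)) ∈ K := hKin (mem_ball_self (by positivity))
  have hyK := depthRegion_subset ⟨0, h0⟩ hKopen hKconv hδ0 hy
  have hlogδ : 0 ≤ Real.log (1 / δ) := Real.log_nonneg (by
    rw [le_div_iff₀ hδ0]; linarith)
  refine mem_hilbertBall_of_dist hKopen hK12 h0 hyK (r₁ := 1 / (2 * d)) (r₂ := δ / (3 * d) ^ d)
    (by positivity) (by positivity) ?_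
    (fun b hb => le_dist_of_mem_depthRegion hd hKopen hKconv hKin hK12 hδ0 hy hb)
    (by positivity) ?_
  · intro b hb
    by_contra h
    refine hb (hKin ?_)
    rw [mem_ball_zero_iff]
    simpa using not_le.1 h
  · have e : 1 / (1 / (2 * (d : ℝ)) * (δ / (3 * d) ^ d)) = (1 / δ) * ((2 * d) * (3 * d) ^ d) := by
      field_simp
    rw [e, Real.log_mul (by positivity) (by positivity),
      Real.log_mul (by positivity) (by positivity), Real.log_pow]
    have l1 := Real.log_le_sub_one_of_pos (show (0 : ℝ) < 2 * d by positivity)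
    have l2 := Real.log_le_sub_one_of_pos (show (0 : ℝ) < 3 * d by positivity)
    have l3 := mul_le_mul_of_nonneg_left l2 hd0.le
    have q1 : (d : ℝ) ≤ d ^ 2 := by nlinarith
    have q2 : (d : ℝ) ^ 2 ≤ d ^ 3 := by nlinarith [sq_nonneg (d : ℝ)]
    nlinarith

theorem depthRegion_subset_hilbertBall_of_zero_notMem {d : ℕ} (hd : 1 ≤ d)
    {K : Set (EuclideanSpace ℝ (Fin d))} (hKopen : IsOpen K) (hKconv : Convex ℝ K)
    (hKin : ball (0 : EuclideanSpace ℝ (Fin d)) (1 / (2 * d)) ⊆ K)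
    (hK12 : K ⊆ ball (0 : EuclideanSpace ℝ (Fin d)) (1 / 2))
    {δ : ℝ} (hδ0 : 0 < δ) (hδ1 : δ ≤ 1 / 2)
    (hzero : (0 : EuclideanSpace ℝ (Fin d)) ∉ depthRegion K δ)
    {x : EuclideanSpace ℝ (Fin d)} (hx : x ∈ depthRegion K δ) :
    depthRegion K δ ⊆ hilbertBall K x ((1 / 2) * Real.log (1 / δ) + 24 * d ^ 3) := by
  intro y hy
  have hd1 : (1 : ℝ) ≤ d := by exact_mod_cast hd
  have hd0 : (0 : ℝ) < d := by linarith
  have h0 : (0 : EuclideanSpace ℝ (Fin d)) ∈ K := hKin (mem_ball_self (by positivity))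
  have hsub := depthRegion_subset ⟨0, h0⟩ hKopen hKconv hδ0
  have hlogδ : 0 ≤ Real.log (1 / δ) := Real.log_nonneg (by
    rw [le_div_iff₀ hδ0]; linarith)
  have hdeep : 1 / (2 * (d : ℝ) ^ d) < δ :=
    (le_halfspaceDepth_zero hd hKin hK12).trans_lt (not_le.1 hzero)
  have hδle : Real.log (1 / δ) ≤ Real.log 2 + d * Real.log d := by
    rw [← Real.log_pow, ← Real.log_mul (by positivity) (by positivity)]
    refine Real.log_le_log (by positivity) ?_
    rw [div_lt_iff₀ (by positivity)] at hdeep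
    rw [div_le_iff₀ hδ0]
    linarith
  refine mem_hilbertBall_of_dist hKopen hK12 (hsub hx) (hsub hy)
    (r₁ := δ / (3 * d) ^ d) (r₂ := δ / (3 * d) ^ d) (by positivity) (by positivity)
    (fun b hb => le_dist_of_mem_depthRegion hd hKopen hKconv hKin hK12 hδ0 hx hb)
    (fun b hb => le_dist_of_mem_depthRegion hd hKopen hKconv hKin hK12 hδ0 hy hb)
    (by positivity) ?_
  have e : 1 / (δ / (3 * (d : ℝ)) ^ d * (δ / (3 * d) ^ d)) =
      ((1 / δ) * (3 * (d : ℝ)) ^ d) ^ 2 := by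
    field_simp
  rw [e, Real.log_pow, Real.log_mul (by positivity) (by positivity), Real.log_pow]
  have l1 := Real.log_le_sub_one_of_pos (show (0 : ℝ) < 2 by norm_num)
  have l2 := Real.log_le_sub_one_of_pos (show (0 : ℝ) < 3 * d by positivity)
  have l3 := mul_le_mul_of_nonneg_left l2 hd0.le
  have l4 := mul_le_mul_of_nonneg_left (Real.log_le_sub_one_of_pos hd0) hd0.le
  have q1 : (d : ℝ) ≤ d ^ 2 := by nlinarith
  have q2 : (d : ℝ) ^ 2 ≤ d ^ 3 := by nlinarith [sq_nonneg (d : ℝ)]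
  push_cast
  nlinarith

theorem stmt2 {d : ℕ} (hd : 1 ≤ d) (K : Set (EuclideanSpace ℝ (Fin d)))
    (hKne : K.Nonempty) (hKopen : IsOpen K) (hKbdd : IsBounded K) (hKconv : Convex ℝ K)
    (hKin : ball (0 : EuclideanSpace ℝ (Fin d)) (1 / (2 * d)) ⊆ K)
    (hK12 : K ⊆ ball (0 : EuclideanSpace ℝ (Fin d)) (1 / 2))
    (δ : ℝ) (hδ0 : 0 < δ) (hδ1 : δ ≤ 1 / 2)
    (hne : (depthRegion K δ).Nonempty) :
    (∃ x ∈ depthRegion K δ,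
        depthRegion K δ ⊆ hilbertBall K x ((1 / 2) * Real.log (1 / δ) + 24 * d ^ 3)) ∧
    ((0 : EuclideanSpace ℝ (Fin d)) ∈ depthRegion K δ →
        depthRegion K δ ⊆ hilbertBall K 0 ((1 / 2) * Real.log (1 / δ) + 24 * d ^ 3)) ∧
    ((0 : EuclideanSpace ℝ (Fin d)) ∉ depthRegion K δ →
        ∀ x ∈ depthRegion K δ,
          depthRegion K δ ⊆ hilbertBall K x ((1 / 2) * Real.log (1 / δ) + 24 * d ^ 3)) := by
  have hz := depthRegion_subset_hilbertBall_zero hd hKopen hKconv hKin hK12 hδ0 hδ1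
  have hx := fun h x hx => depthRegion_subset_hilbertBall_of_zero_notMem hd hKopen hKconv hKin hK12
    hδ0 hδ1 h (x := x) hx
  refine ⟨?_, fun _ => hz, hx⟩
  by_cases h : (0 : EuclideanSpace ℝ (Fin d)) ∈ depthRegion K δ
  · exact ⟨0, h, hz⟩
  · obtain ⟨x, hxm⟩ := hne
    exact ⟨x, hxm, hx h x hxm⟩
end

section
/- Let d ≥ 1, let K ⊂ ℝ^d be an open convex body, and let γ ∈ (0,1/2] be such that B(o,γ) ⊂ K ⊂ B(o,1/2). Then for every x ∈ K∖{o}, ray(x) ≤ dist(x, ∂K)/(2γ). -/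
open MeasureTheory Metric Bornology
open scoped InnerProductSpace Pointwise

/-- If an open convex set `K` contains the ball of radius `γ` about the origin and `t • x` lies in
its frontier, then every frontier point of `K` is at distance at least `γ * (1 - t⁻¹)` from `x`. -/
theorem le_dist_of_mem_frontier {E : Type*} [NormedAddCommGroup E] [NormedSpace ℝ E] {K : Set E}
    (hKopen : IsOpen K) (hKconv : Convex ℝ K) {γ : ℝ} (hγK : ball (0 : E) γ ⊆ K)
    {t : ℝ} (ht : 1 ≤ t) {x z : E} (hp : t • x ∈ frontier K) (hz : z ∈ frontier K) :
    γ * (1 - t⁻¹) ≤ dist x z := by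
  by_contra! h
  have ht0 : 0 < t := by linarith
  have hs : 0 < 1 - t⁻¹ := by
    refine (sub_nonneg.2 (inv_le_one_of_one_le₀ ht)).lt_of_ne fun h0 => ?_
    rw [← h0, mul_zero] at h
    exact h.not_ge dist_nonneg
  have hu : (1 - t⁻¹)⁻¹ • (z - x) ∈ K := by
    refine hγK (mem_ball_zero_iff.2 ?_)
    rw [norm_smul, norm_inv, Real.norm_of_nonneg hs.le, inv_mul_lt_iff₀ hs, ← dist_eq_norm,
      dist_comm, mul_comm]
    exact h
  have hmem := hKconv.combo_interior_closure_mem_interior (hKopen.interior_eq.symm ▸ hu)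
    (frontier_subset_closure hp) hs (inv_nonneg.2 ht0.le) (sub_add_cancel _ _)
  rw [smul_inv_smul₀ hs.ne', inv_smul_smul₀ ht0.ne', sub_add_cancel] at hmem
  exact hz.2 hmem

theorem stmt5 {d : ℕ} (hd : 1 ≤ d) (K : Set (EuclideanSpace ℝ (Fin d)))
    (hKne : K.Nonempty) (hKopen : IsOpen K) (hKbdd : IsBounded K) (hKconv : Convex ℝ K)
    (γ : ℝ) (hγ0 : 0 < γ) (hγ1 : γ ≤ 1 / 2)
    (hγK : ball (0 : EuclideanSpace ℝ (Fin d)) γ ⊆ K)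
    (hK12 : K ⊆ ball (0 : EuclideanSpace ℝ (Fin d)) (1 / 2)) :
    ∀ x ∈ K, x ≠ 0 →
      ∀ p : EuclideanSpace ℝ (Fin d), p ∈ frontier K → (∃ t : ℝ, 1 ≤ t ∧ p = t • x) →
        ‖x - p‖ ≤ Metric.infDist x (frontier K) / (2 * γ) := by
  rintro x - - p hp ⟨t, ht, rfl⟩
  have ht0 : 0 < t := by linarith
  have hnorm : ‖t • x‖ ≤ 1 / 2 := by
    have h := closure_ball_subset_closedBall (closure_mono hK12 (frontier_subset_closure hp))
    simpa using h
  rw [le_div_iff₀ (by positivity)]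
  have hs : 0 ≤ 1 - t⁻¹ := sub_nonneg.2 (inv_le_one_of_one_le₀ ht)
  have hdist : ‖x - t • x‖ = (1 - t⁻¹) * ‖t • x‖ := by
    have e : x - t • x = -((1 - t⁻¹) • (t • x)) := by
      rw [sub_smul, one_smul, inv_smul_smul₀ ht0.ne']
      abel
    rw [e, norm_neg, norm_smul, Real.norm_of_nonneg hs]
  have hball : γ * (1 - t⁻¹) ≤ infDist x (frontier K) :=
    (le_infDist ⟨_, hp⟩).2 fun z hz =>
      le_dist_of_mem_frontier hKopen hKconv hγK ht hp hz
  calc ‖x - t • x‖ * (2 * γ) = γ * (1 - t⁻¹) * (2 * ‖t • x‖) := by rw [hdist]; ring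
    _ ≤ γ * (1 - t⁻¹) * 1 := by gcongr; linarith
    _ ≤ infDist x (frontier K) := by rwa [mul_one]
end

section
/- Let d ≥ 1, let K ⊂ ℝ^d be an open convex body, and let γ ∈ (0,1/2] be such that B(o,γ) ⊂ K ⊂ B(o,1/2). Then for every r ∈ ℝ, B_K(o, r) ⊆ (1 − e^{−2r})·K ⊆ B_K(o, r + (1/2)·ln(1 + 1/(2γ))). -/
open MeasureTheory Metric Bornology
open scoped InnerProductSpace Pointwise

/-- The Hilbert distance from the origin, expressed through the gauge of the convex body. -/
theorem hilbertDist_zero_eq_gauge {d : ℕ} {K : Set (EuclideanSpace ℝ (Fin d))}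
    (hKopen : IsOpen K) (hKbdd : IsBounded K) (hKconv : Convex ℝ K)
    (h0 : (0 : EuclideanSpace ℝ (Fin d)) ∈ K) {q : EuclideanSpace ℝ (Fin d)} (hq : q ∈ K) :
    hilbertDist K 0 q = (1 / 2) * Real.log ((1 + gauge K (-q)) / (1 - gauge K q)) := by
  have hn : K ∈ nhds 0 := hKopen.mem_nhds h0
  have habs : Absorbent ℝ K := absorbent_nhds_zero hn
  have hfr : ∀ x, x ∈ frontier K ↔ gauge K x = 1 := fun x =>
    (gauge_eq_one_iff_mem_frontier hKconv hn).symm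
  rcases eq_or_ne q 0 with rfl | hq0
  · have hset : {r : ℝ | ((0 : EuclideanSpace ℝ (Fin d)) = 0 ∧ r = 0) ∨
        ∃ a b : EuclideanSpace ℝ (Fin d), a ∈ frontier K ∧ b ∈ frontier K ∧
          (∃ t : ℝ, t < 0 ∧ a = 0 + t • ((0 : EuclideanSpace ℝ (Fin d)) - 0)) ∧
          (∃ s : ℝ, 1 < s ∧ b = 0 + s • ((0 : EuclideanSpace ℝ (Fin d)) - 0)) ∧
          r = (1 / 2) * Real.log ((‖(0 : EuclideanSpace ℝ (Fin d)) - a‖ * ‖0 - b‖) /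
            (‖0 - a‖ * ‖0 - b‖))} = {0} := by
      ext r
      simp only [Set.mem_ofPred_eq, Set.mem_singleton_iff]
      constructor
      · rintro (⟨-, h⟩ | ⟨a, b, ha, -, ⟨t, -, rfl⟩, -⟩)
        · exact h
        · simp [hfr] at ha
      · exact fun h => Or.inl ⟨trivial, h⟩
    rw [hilbertDist, hset]
    simp
  have hpos : ∀ x : EuclideanSpace ℝ (Fin d), x ≠ 0 → 0 < gauge K x := fun x hx =>
    (gauge_pos habs (NormedSpace.isVonNBounded_iff ℝ |>.2 hKbdd)).2 hx
  have hg := hpos q hq0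
  have hg' := hpos (-q) (neg_ne_zero.2 hq0)
  have hg1 : gauge K q < 1 := gauge_lt_one_of_mem_of_isOpen hKopen hq
  have hnq : ‖q‖ ≠ 0 := norm_ne_zero_iff.2 hq0
  have hratio : ∀ t s : ℝ, t < 0 → 1 < s →
      ‖q - t • q‖ * ‖0 - s • q‖ / (‖0 - t • q‖ * ‖q - s • q‖) =
        (1 - t) * s / (-t * (s - 1)) := by
    intro t s ht hs
    have h1 : q - t • q = (1 - t) • q := by module
    have h2 : q - s • q = (1 - s) • q := by module
    rw [h1, h2, zero_sub, zero_sub, norm_neg, norm_neg]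
    simp only [norm_smul, Real.norm_eq_abs]
    rw [abs_of_pos (by linarith : 0 < 1 - t), abs_of_pos (by linarith : 0 < s), abs_of_neg ht,
      abs_of_neg (by linarith : 1 - s < 0), neg_sub]
    have : s - 1 ≠ 0 := by linarith
    field_simp
  have hgt : ∀ t : ℝ, t < 0 → gauge K (t • q) = -t * gauge K (-q) := by
    intro t ht
    rw [← neg_smul_neg, gauge_smul_of_nonneg (by linarith), smul_eq_mul]
  have hgs : ∀ s : ℝ, 1 < s → gauge K (s • q) = s * gauge K q := by
    intro s hs
    rw [gauge_smul_of_nonneg (by linarith), smul_eq_mul]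
  have hval : ∀ g g' : ℝ, 0 < g → 0 < g' → g < 1 →
      (1 - -g'⁻¹) * g⁻¹ / (- -g'⁻¹ * (g⁻¹ - 1)) = (1 + g') / (1 - g) := by
    intro g g' h h' h1
    have : 1 - g ≠ 0 := by linarith
    have : g⁻¹ - 1 = (1 - g) / g := by field_simp
    rw [this]
    field_simp
    ring
  have hset : {r : ℝ | ((0 : EuclideanSpace ℝ (Fin d)) = q ∧ r = 0) ∨
      ∃ a b : EuclideanSpace ℝ (Fin d), a ∈ frontier K ∧ b ∈ frontier K ∧
        (∃ t : ℝ, t < 0 ∧ a = 0 + t • (q - 0)) ∧ (∃ s : ℝ, 1 < s ∧ b = 0 + s • (q - 0)) ∧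
        r = (1 / 2) * Real.log ((‖q - a‖ * ‖0 - b‖) / (‖0 - a‖ * ‖q - b‖))} =
      {(1 / 2) * Real.log ((1 + gauge K (-q)) / (1 - gauge K q))} := by
    ext r
    simp only [Set.mem_ofPred_eq, Set.mem_singleton_iff, zero_add, sub_zero]
    constructor
    · rintro (⟨h, -⟩ | ⟨a, b, ha, hb, ⟨t, ht, rfl⟩, ⟨s, hs, rfl⟩, rfl⟩)
      · exact absurd h.symm hq0
      · rw [hfr, hgt t ht] at ha
        rw [hfr, hgs s hs] at hb
        have ht' : t = -(gauge K (-q))⁻¹ := by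
          rw [← eq_inv_of_mul_eq_one_left ha, neg_neg]
        rw [hratio t s ht hs, ht', eq_inv_of_mul_eq_one_left hb, hval _ _ hg hg' hg1]
    · rintro rfl
      have ht : -(gauge K (-q))⁻¹ < 0 := neg_lt_zero.2 (inv_pos.2 hg')
      have hs : 1 < (gauge K q)⁻¹ := (one_lt_inv₀ hg).2 hg1
      refine Or.inr ⟨_, _, ?_, ?_, ⟨_, ht, rfl⟩, ⟨_, hs, rfl⟩, ?_⟩
      · rw [hfr, hgt _ ht, neg_neg, inv_mul_cancel₀ hg'.ne']
      · rw [hfr, hgs _ hs, inv_mul_cancel₀ hg.ne']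
      · rw [hratio _ _ ht hs, hval _ _ hg hg' hg1]
  rw [hilbertDist, hset, csInf_singleton]

/-- Membership in a positive dilate of an open convex body around the origin, via the gauge. -/
theorem mem_dilate_iff_gauge_lt {d : ℕ} {K : Set (EuclideanSpace ℝ (Fin d))}
    (hKopen : IsOpen K) (hKconv : Convex ℝ K) (h0 : (0 : EuclideanSpace ℝ (Fin d)) ∈ K)
    {lam : ℝ} {q : EuclideanSpace ℝ (Fin d)} :
    q ∈ dilate lam K ↔ gauge K q < lam := by
  have key : 0 < lam → (q ∈ lam • K ↔ gauge K q < lam) := by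
    intro hlam
    have hK : ∀ x, x ∈ K ↔ gauge K x < 1 := fun x =>
      ⟨gauge_lt_one_of_mem_of_isOpen hKopen, fun hx =>
        setOfPred_gauge_lt_one_subset_self hKconv h0 (absorbent_nhds_zero (hKopen.mem_nhds h0)) hx⟩
    rw [Set.mem_smul_set_iff_inv_smul_mem₀ hlam.ne', hK,
      gauge_smul_of_nonneg (inv_nonneg.2 hlam.le), smul_eq_mul, inv_mul_lt_one₀ hlam]
  exact ⟨fun h => (key h.1).1 h.2, fun h => ⟨(gauge_nonneg q).trans_lt h,
    (key ((gauge_nonneg q).trans_lt h)).2 h⟩⟩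


theorem stmt6 {d : ℕ} (hd : 1 ≤ d) (K : Set (EuclideanSpace ℝ (Fin d)))
    (hKne : K.Nonempty) (hKopen : IsOpen K) (hKbdd : IsBounded K) (hKconv : Convex ℝ K)
    (γ : ℝ) (hγ0 : 0 < γ) (hγ1 : γ ≤ 1 / 2)
    (hγK : ball (0 : EuclideanSpace ℝ (Fin d)) γ ⊆ K)
    (hK12 : K ⊆ ball (0 : EuclideanSpace ℝ (Fin d)) (1 / 2)) :
    ∀ r : ℝ,
      hilbertBall K 0 r ⊆ dilate (1 - Real.exp (-2 * r)) K ∧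
      dilate (1 - Real.exp (-2 * r)) K ⊆
        hilbertBall K 0 (r + (1 / 2) * Real.log (1 + 1 / (2 * γ))) := by
  have h0 : (0 : EuclideanSpace ℝ (Fin d)) ∈ K := hγK (mem_ball_self hγ0)
  have hdist := fun q (hq : q ∈ K) => hilbertDist_zero_eq_gauge hKopen hKbdd hKconv h0 hq
  intro r
  have hexp : Real.exp (-2 * r) * Real.exp (2 * r) = 1 := by
    rw [← Real.exp_add]; simp
  have he : 0 < Real.exp (2 * r) := Real.exp_pos _
  have he' : 0 < Real.exp (-2 * r) := Real.exp_pos _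
  constructor
  · rintro q ⟨-, hq, hd⟩
    rw [mem_dilate_iff_gauge_lt hKopen hKconv h0]
    have hg1 : 0 < 1 - gauge K q := sub_pos.2 (gauge_lt_one_of_mem_of_isOpen hKopen hq)
    have hg' := gauge_nonneg (s := K) (-q)
    rw [hdist q hq] at hd
    have hlog : Real.log ((1 + gauge K (-q)) / (1 - gauge K q)) < 2 * r := by linarith
    rw [Real.log_lt_iff_lt_exp (by positivity), div_lt_iff₀ hg1] at hlog
    nlinarith
  · intro q hq
    have hlam := hq.1
    rw [mem_dilate_iff_gauge_lt hKopen hKconv h0] at hq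
    have hr : 0 < r := by
      have : Real.exp (-2 * r) < 1 := by linarith
      rw [Real.exp_lt_one_iff] at this
      linarith
    have hg1 : 0 < 1 - gauge K q := by linarith
    have hqK : q ∈ K :=
      setOfPred_gauge_lt_one_subset_self hKconv h0 (absorbent_nhds_zero (hKopen.mem_nhds h0))
        (by simpa using hg1)
    have hg0 := gauge_nonneg (s := K) (-q)
    have hg' : gauge K (-q) ≤ 1 / (2 * γ) := by
      have hle : gauge K (-q) ≤ gauge (ball 0 γ) (-q) :=
        gauge_mono (absorbent_ball_zero hγ0) hγK _
      have hnorm : ‖q‖ < 1 / 2 := by simpa using hK12 hqK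
      rw [gauge_ball hγ0.le, norm_neg] at hle
      refine hle.trans ?_
      rw [div_le_div_iff₀ hγ0 (by positivity)]
      nlinarith
    have hc : 0 < 1 + 1 / (2 * γ) := by positivity
    refine ⟨?_, hqK, ?_⟩
    · have : 0 ≤ Real.log (1 + 1 / (2 * γ)) :=
        Real.log_nonneg (le_add_of_nonneg_right (by positivity))
      linarith
    · have hlog : Real.log (1 + gauge K (-q)) ≤ Real.log (1 + 1 / (2 * γ)) :=
        Real.log_le_log (by positivity) (by linarith)
      have hlog' : -2 * r < Real.log (1 - gauge K q) :=
        (Real.lt_log_iff_exp_lt hg1).2 (by linarith)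
      rw [hdist q hqK, Real.log_div (by positivity) hg1.ne']
      linarith
end

section
/- Let d ≥ 1 and let K ⊂ ℝ^d be an open convex body with K ⊂ B(o,1/2). Then for all z, w ∈ K, d_K(z, w) ≥ ln(1 + ‖z − w‖). -/
open MeasureTheory Metric Bornology
open scoped InnerProductSpace Pointwise

/-- A ray starting in a bounded open set leaves it through the frontier. -/
theorem exists_pos_add_smul_mem_frontier {E : Type*} [NormedAddCommGroup E] [NormedSpace ℝ E]
    {K : Set E} (hKopen : IsOpen K) (hKbdd : IsBounded K) {z u : E} (hz : z ∈ K) (hu : u ≠ 0) :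
    ∃ t : ℝ, 0 < t ∧ z + t • u ∈ frontier K := by
  obtain ⟨R, hR⟩ := hKbdd.subset_closedBall z
  have hR0 : 0 ≤ R := by simpa using (mem_closedBall.1 (hR hz))
  have hu' : 0 < ‖u‖ := norm_pos_iff.2 hu
  have hcon : IsPreconnected ((fun t : ℝ => z + t • u) '' Set.Ici 0) :=
    isPreconnected_Ici.image _ (by fun_prop)
  have hout : z + ((R + 1) / ‖u‖) • u ∉ K := by
    intro h
    have h1 := mem_closedBall.1 (hR h)
    rw [dist_eq_norm, add_sub_cancel_left, norm_smul, Real.norm_of_nonneg (by positivity),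
      div_mul_cancel₀ _ hu'.ne'] at h1
    linarith
  obtain ⟨t, ht, hy⟩ : ∃ t : ℝ, 0 ≤ t ∧ z + t • u ∈ frontier K := by
    by_contra! h
    simp only [hKopen.frontier_eq, Set.mem_sdiff, not_and, not_not] at h
    have hT : 0 ≤ (R + 1) / ‖u‖ := by positivity
    obtain ⟨y, -, hyK, hyc⟩ := hcon K (closure K)ᶜ hKopen isClosed_closure.isOpen_compl
      (by
        rintro _ ⟨t, ht, rfl⟩
        by_cases hc : z + t • u ∈ closure K
        · exact Or.inl (h t ht hc)
        · exact Or.inr hc)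
      ⟨z, ⟨0, by simp, by simp⟩, hz⟩
      ⟨_, ⟨(R + 1) / ‖u‖, hT, rfl⟩, fun hc => hout (h _ hT hc)⟩
    exact hyc (subset_closure hyK)
  refine ⟨t, lt_of_le_of_ne ht ?_, hy⟩
  rintro rfl
  rw [hKopen.frontier_eq] at hy
  exact hy.2 (by simpa using hz)

/-- Lower bound for the logarithmic cross ratio in a chord of length at most `1`, where the chord
is parametrized so that the two inner points have parameters `0` and `1`. -/
theorem log_one_add_le_half_log_crossRatio {D t s : ℝ} (hD : 0 < D) (ht : t < 0) (hs : 1 < s)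
    (hle : (s - t) * D ≤ 1) :
    Real.log (1 + D) ≤
      (1 / 2) * Real.log (((1 - t) * D * (s * D)) / (-t * D * ((s - 1) * D))) := by
  have hx : 0 < -t * D := mul_pos (by linarith) hD
  have hy : 0 < (s - 1) * D := mul_pos (by linarith) hD
  have hx1 : 1 + D ≤ ((1 - t) * D) / (-t * D) := by
    rw [le_div_iff₀ hx]
    nlinarith
  have hy1 : 1 + D ≤ (s * D) / ((s - 1) * D) := by
    rw [le_div_iff₀ hy]
    nlinarith
  have hsq : (1 + D) ^ 2 ≤ ((1 - t) * D * (s * D)) / (-t * D * ((s - 1) * D)) := by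
    rw [mul_div_mul_comm, sq]
    gcongr
    linarith
  have hlog := Real.log_le_log (by positivity) hsq
  rw [Real.log_pow] at hlog
  push_cast at hlog
  linarith

theorem stmt8 {d : ℕ} (hd : 1 ≤ d) (K : Set (EuclideanSpace ℝ (Fin d)))
    (hKne : K.Nonempty) (hKopen : IsOpen K) (hKbdd : IsBounded K) (hKconv : Convex ℝ K)
    (hK12 : K ⊆ ball (0 : EuclideanSpace ℝ (Fin d)) (1 / 2)) :
    ∀ z ∈ K, ∀ w ∈ K, Real.log (1 + ‖z - w‖) ≤ hilbertDist K z w := by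
  intro z hz w hw
  have hcl : ∀ x ∈ frontier K, ‖x‖ ≤ 1 / 2 := fun x hx => by
    simpa using closure_ball_subset_closedBall (closure_mono hK12 (frontier_subset_closure hx))
  apply le_csInf
  · by_cases hzw : z = w
    · exact ⟨0, Or.inl ⟨hzw, rfl⟩⟩
    · obtain ⟨t, ht, ha⟩ :=
        exists_pos_add_smul_mem_frontier hKopen hKbdd hz (sub_ne_zero.2 hzw)
      obtain ⟨s, hs, hb⟩ :=
        exists_pos_add_smul_mem_frontier hKopen hKbdd hw (sub_ne_zero.2 (Ne.symm hzw))
      exact ⟨_, Or.inr ⟨_, _, ha, hb, ⟨-t, by linarith, by module⟩,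
        ⟨1 + s, by linarith, by module⟩, rfl⟩⟩
  · rintro r (⟨rfl, rfl⟩ | ⟨a, b, ha, hb, ⟨t, ht, rfl⟩, ⟨s, hs, rfl⟩, rfl⟩)
    · simp
    · have hzw : w - z ≠ 0 := by
        intro h
        rw [h, smul_zero, add_zero, hKopen.frontier_eq] at ha
        exact ha.2 hz
      have hab : (s - t) * ‖w - z‖ ≤ 1 := by
        have h := norm_sub_le (z + s • (w - z)) (z + t • (w - z))
        rw [show z + s • (w - z) - (z + t • (w - z)) = (s - t) • (w - z) by module, norm_smul,
          Real.norm_of_nonneg (by linarith)] at h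
        linarith [hcl _ ha, hcl _ hb]
      have hwa : ‖w - (z + t • (w - z))‖ = (1 - t) * ‖w - z‖ := by
        rw [show w - (z + t • (w - z)) = (1 - t) • (w - z) by module, norm_smul,
          Real.norm_of_nonneg (by linarith)]
      have hzb : ‖z - (z + s • (w - z))‖ = s * ‖w - z‖ := by
        rw [sub_add_cancel_left, norm_neg, norm_smul, Real.norm_of_nonneg (by linarith)]
      have hza : ‖z - (z + t • (w - z))‖ = -t * ‖w - z‖ := by
        rw [sub_add_cancel_left, norm_neg, norm_smul, Real.norm_of_nonpos ht.le]
      have hwb : ‖w - (z + s • (w - z))‖ = (s - 1) * ‖w - z‖ := by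
        rw [show w - (z + s • (w - z)) = -((s - 1) • (w - z)) by module, norm_neg, norm_smul,
          Real.norm_of_nonneg (by linarith)]
      rw [hwa, hzb, hza, hwb, norm_sub_rev z w]
      exact log_one_add_le_half_log_crossRatio (norm_pos_iff.2 hzw) ht hs hab
end

section
/- Let d ≥ 1 and let K ⊂ ℝ^d be an open convex body with K ⊂ B(o,1/2). Then for all z, w ∈ ℝ^d, D_K(w) ≥ D_K(z) − ‖z − w‖/|K|. -/
open MeasureTheory Metric Bornology
open scoped InnerProductSpace Pointwise

/-- A slab of width `c - a` orthogonal to a unit vector meets the ball of diameter one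
in a set of volume at most `c - a`. -/
theorem volume_ball_inter_slab_le {d : ℕ} (v : EuclideanSpace ℝ (Fin d)) (hv : ‖v‖ = 1)
    (a c : ℝ) :
    volume {x : EuclideanSpace ℝ (Fin d) |
      x ∈ ball (0 : EuclideanSpace ℝ (Fin d)) (1 / 2) ∧ a ≤ ⟪v, x⟫_ℝ ∧ ⟪v, x⟫_ℝ < c}
      ≤ ENNReal.ofReal (c - a) := by
  obtain ⟨i₀⟩ : Nonempty (Fin d) := by
    by_contra h
    rw [not_nonempty_iff] at h
    simp [Subsingleton.elim v 0] at hv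
  obtain ⟨b, hb⟩ := Orthonormal.exists_orthonormalBasis_extension_of_card_eq
    (𝕜 := ℝ) (E := EuclideanSpace ℝ (Fin d)) (ι := Fin d) (by simp) (v := fun _ => v)
    (s := {i₀}) ⟨fun _ => hv, fun i j hij => (hij (Subsingleton.elim i j)).elim⟩
  have hbv : b i₀ = v := hb i₀ rfl
  have hmp : MeasurePreserving
      (fun x : EuclideanSpace ℝ (Fin d) => WithLp.ofLp (b.repr x)) volume volume :=
    (EuclideanSpace.volume_preserving_symm_measurableEquiv_toLp (Fin d)).comp
      b.measurePreserving_repr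
  let S : Fin d → Set ℝ := fun i => if i = i₀ then Set.Ico a c else Set.Icc (-(1 / 2)) (1 / 2)
  have hS : MeasurableSet (Set.univ.pi S) := by
    refine MeasurableSet.univ_pi fun i => ?_
    by_cases h : i = i₀ <;> simp [S, h, measurableSet_Ico, measurableSet_Icc]
  calc _ ≤ volume ((fun x : EuclideanSpace ℝ (Fin d) => WithLp.ofLp (b.repr x)) ⁻¹'
        Set.univ.pi S) := by
        refine measure_mono ?_
        rintro x ⟨hx, h₁, h₂⟩
        refine Set.mem_univ_pi.2 fun i => ?_
        by_cases h : i = i₀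
        · subst h
          simpa [S, b.repr_apply_apply, hbv] using ⟨h₁, h₂⟩
        · have hi : |⟪b i, x⟫_ℝ| ≤ 1 / 2 := by
            have := abs_real_inner_le_norm (b i) x
            rw [b.orthonormal.1 i, one_mul] at this
            exact this.trans (mem_ball_zero_iff.1 hx).le
          simpa only [S, h, if_false, b.repr_apply_apply, Set.mem_Icc] using abs_le.1 hi
    _ = ∏ i, volume (S i) := by
        rw [hmp.measure_preimage hS.nullMeasurableSet, volume_pi_pi]
    _ = volume (S i₀) := by
        refine Finset.prod_eq_single i₀ (fun i _ h => ?_) (by simp)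
        simp only [S, h, if_false, Real.volume_Icc]
        norm_num
    _ = ENNReal.ofReal (c - a) := by simp [S]

theorem stmt9 {d : ℕ} (hd : 1 ≤ d) (K : Set (EuclideanSpace ℝ (Fin d)))
    (hKne : K.Nonempty) (hKopen : IsOpen K) (hKbdd : IsBounded K) (hKconv : Convex ℝ K)
    (hK12 : K ⊆ ball (0 : EuclideanSpace ℝ (Fin d)) (1 / 2)) :
    ∀ z w : EuclideanSpace ℝ (Fin d),
      halfspaceDepth K z - ‖z - w‖ / (volume K).toReal ≤ halfspaceDepth K w := by
  intro z w
  have : Nonempty {v : EuclideanSpace ℝ (Fin d) // ‖v‖ = 1} :=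
    ⟨⟨EuclideanSpace.single ⟨0, hd⟩ 1, by simp⟩⟩
  refine le_ciInf fun v => ?_
  have hbdd : BddBelow (Set.range fun v : {v : EuclideanSpace ℝ (Fin d) // ‖v‖ = 1} =>
      (volume {x : EuclideanSpace ℝ (Fin d) |
        x ∈ K ∧ 0 ≤ ⟪(v : EuclideanSpace ℝ (Fin d)), x - z⟫_ℝ}).toReal / (volume K).toReal) :=
    ⟨0, by rintro _ ⟨v, rfl⟩; positivity⟩
  rw [sub_le_iff_le_add]
  refine (ciInf_le hbdd v).trans ?_
  rw [← add_div]
  refine div_le_div_of_nonneg_right ?_ ENNReal.toReal_nonneg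
  obtain ⟨v, hv⟩ := v
  have hfin : volume {x | x ∈ K ∧ 0 ≤ ⟪v, x - w⟫_ℝ} ≠ ⊤ :=
    ((measure_mono fun _ hx => hx.1).trans_lt hKbdd.measure_lt_top).ne
  have hwz : ⟪v, w⟫_ℝ - ⟪v, z⟫_ℝ ≤ ‖z - w‖ := by
    rw [← inner_sub_right, norm_sub_rev]
    simpa [hv] using real_inner_le_norm v (w - z)
  refine ENNReal.toReal_le_of_le_ofReal (by positivity) ?_
  rw [ENNReal.ofReal_add ENNReal.toReal_nonneg (norm_nonneg _), ENNReal.ofReal_toReal hfin]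
  refine (measure_mono fun x hx => ?_).trans ((measure_union_le _ _).trans
    (add_le_add le_rfl ((volume_ball_inter_slab_le v hv ⟪v, z⟫_ℝ ⟪v, w⟫_ℝ).trans
      (ENNReal.ofReal_le_ofReal hwz))))
  have h := hx.2
  simp only [inner_sub_right, sub_nonneg] at h
  by_cases hw : ⟪v, w⟫_ℝ ≤ ⟪v, x⟫_ℝ
  · exact Or.inl ⟨hx.1, by simpa only [inner_sub_right, sub_nonneg] using hw⟩
  · exact Or.inr ⟨hK12 hx.1, h, not_le.1 hw⟩
end

section
/- Let d ≥ 1, let K ⊂ ℝ^d be an open convex body, let δ ∈ (0,1/2], and let z ∈ ∂K_δ. Then there exists a closed halfspace H₊ with boundary hyperplane H such that: z ∈ H; K_δ is contained in the complementary closed halfspace (so that H is a supporting hyperplane of K_δ at z); |K ∩ H₊| = δ·|K|; H ∩ K_δ = {z}; and z is the centroid of K ∩ H with respect to (d−1)-dimensional Hausdorff measure. -/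
open MeasureTheory Metric Bornology
open scoped InnerProductSpace Pointwise

theorem volume_inter_Ici_toReal {B : Set ℝ} (hB : MeasurableSet B) (hfin : volume B ≠ ⊤) (a : ℝ) :
    (volume (B ∩ Set.Ici a)).toReal
      = (volume (B ∩ Set.Ici 0)).toReal - ∫ t in (0 : ℝ)..a, B.indicator (1 : ℝ → ℝ) t := by
  have key : ∀ b : ℝ, (volume (B ∩ Set.Ici b)).toReal
      = ∫ t in Set.Ioi b, B.indicator (1 : ℝ → ℝ) t := by
    intro b
    rw [← integral_Ici_eq_integral_Ioi, integral_indicator_one hB, measureReal_def,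
      Measure.restrict_apply hB]
  have hint : Integrable (B.indicator (1 : ℝ → ℝ)) volume :=
    (integrable_indicator_iff hB).2 (integrableOn_const hfin)
  rw [key, key, ← intervalIntegral.integral_Ioi_sub_Ioi' hint.integrableOn hint.integrableOn]
  ring

theorem abs_volume_inter_Ici_sub_le {B : Set ℝ} (hB : MeasurableSet B) (hfin : volume B ≠ ⊤)
    (a b : ℝ) :
    |(volume (B ∩ Set.Ici a)).toReal - (volume (B ∩ Set.Ici b)).toReal| ≤ |a - b| := by
  have hint : Integrable (B.indicator (1 : ℝ → ℝ)) volume :=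
    (integrable_indicator_iff hB).2 (integrableOn_const hfin)
  rw [volume_inter_Ici_toReal hB hfin a, volume_inter_Ici_toReal hB hfin b, sub_sub_sub_cancel_left,
    intervalIntegral.integral_interval_sub_left hint.intervalIntegrable hint.intervalIntegrable,
    ← Real.norm_eq_abs, abs_sub_comm]
  refine (intervalIntegral.norm_integral_le_of_norm_le_const (C := 1) fun t _ => ?_).trans (by simp)
  exact (norm_indicator_le_norm_self _ _).trans (by simp)

theorem hasDerivAt_volume_inter_Ici {B : Set ℝ} (hB : MeasurableSet B) (hfin : volume B ≠ ⊤)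
    (h0 : (0 : ℝ) ∉ frontier B) (k : ℝ) :
    HasDerivAt (fun s : ℝ => (volume (B ∩ Set.Ici (-(s * k)))).toReal)
      (B.indicator (1 : ℝ → ℝ) 0 * k) 0 := by
  have hint : Integrable (B.indicator (1 : ℝ → ℝ)) volume :=
    (integrable_indicator_iff hB).2 (integrableOn_const hfin)
  have hcont : ContinuousAt (B.indicator (1 : ℝ → ℝ)) 0 :=
    continuous_one.continuousOn.continuousAt_indicator h0
  have h1 : HasDerivAt (fun u => ∫ t in (0 : ℝ)..u, B.indicator (1 : ℝ → ℝ) t)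
      (B.indicator (1 : ℝ → ℝ) 0) (-(0 * k)) := by
    rw [zero_mul, neg_zero]
    exact intervalIntegral.integral_hasDerivAt_right hint.intervalIntegrable
      hint.aestronglyMeasurable.stronglyMeasurableAtFilter hcont
  have h2 : HasDerivAt (fun s : ℝ => -(s * k)) (-(1 * k)) 0 := ((hasDerivAt_id 0).mul_const k).neg
  have h3 := (h1.comp (0 : ℝ) h2).const_sub (volume (B ∩ Set.Ici 0)).toReal
  simp_rw [volume_inter_Ici_toReal hB hfin (-(_ * k))]
  exact h3.congr_deriv (by ring)

theorem hasDerivAt_prod_inter_halfspace {F : Type*} [NormedAddCommGroup F] [InnerProductSpace ℝ F]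
    [FiniteDimensional ℝ F] [MeasurableSpace F] [BorelSpace F] (μ : Measure F) [μ.IsAddHaarMeasure]
    {A : Set (F × ℝ)} (hA : IsOpen A) (hAc : Convex ℝ A) (hAb : IsBounded A)
    (hne : ∃ y, (y, (0 : ℝ)) ∈ A) (w : F) :
    HasDerivAt
      (fun s : ℝ => ((μ.prod volume) (A ∩ {p | 0 ≤ p.2 + s * ⟪w, p.1⟫_ℝ})).toReal)
      (∫ y in {y | (y, (0 : ℝ)) ∈ A}, ⟪w, y⟫_ℝ ∂μ) 0 := by
  obtain ⟨R, hR⟩ := hAb.subset_closedBall 0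
  have hbd : ∀ p ∈ A, ‖p.1‖ ≤ R ∧ |p.2| ≤ R := by
    intro p hp
    have := mem_closedBall_zero_iff.1 (hR hp)
    exact ⟨(norm_fst_le p).trans this, (norm_snd_le p).trans this⟩
  have hcontMk : ∀ y : F, Continuous fun t : ℝ => (y, t) := fun y => by fun_prop
  set B : F → Set ℝ := fun y => Prod.mk y ⁻¹' A with hBdef
  have hBm : ∀ y, MeasurableSet (B y) := fun y => (hA.preimage (hcontMk y)).measurableSet
  have hBfin : ∀ y, volume (B y) ≠ ⊤ := by
    intro y
    refine ((measure_mono (t := Set.Icc (-R) R) fun t ht => ?_).trans_lt (by simp)).ne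
    exact abs_le.1 (hbd _ ht).2
  have hHm : ∀ s : ℝ, MeasurableSet (A ∩ {p : F × ℝ | 0 ≤ p.2 + s * ⟪w, p.1⟫_ℝ}) := fun s =>
    hA.measurableSet.inter (isClosed_le (by fun_prop) (by fun_prop)).measurableSet
  have hslice : ∀ (s : ℝ) (y : F), Prod.mk y ⁻¹' (A ∩ {p : F × ℝ | 0 ≤ p.2 + s * ⟪w, p.1⟫_ℝ})
      = B y ∩ Set.Ici (-(s * ⟪w, y⟫_ℝ)) := by
    intro s y
    ext t
    simp only [hBdef, Set.mem_preimage, Set.mem_inter_iff, Set.mem_ofPred_eq, Set.mem_Ici,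
      neg_le_iff_add_nonneg]
  have hmeas : ∀ s : ℝ, Measurable fun y => volume (B y ∩ Set.Ici (-(s * ⟪w, y⟫_ℝ))) := by
    intro s
    simp_rw [← hslice]
    exact measurable_measure_prodMk_left (hHm s)
  have hVol : ∀ s : ℝ, ((μ.prod volume) (A ∩ {p : F × ℝ | 0 ≤ p.2 + s * ⟪w, p.1⟫_ℝ})).toReal
      = ∫ y, (volume (B y ∩ Set.Ici (-(s * ⟪w, y⟫_ℝ)))).toReal ∂μ := by
    intro s
    rw [Measure.prod_apply (hHm s), integral_toReal (hmeas s).aemeasurable]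
    · simp_rw [hslice]
    · exact Filter.Eventually.of_forall fun y =>
        (measure_mono Set.inter_subset_left).trans_lt (hBfin y).lt_top
  simp_rw [hVol]
  set A₀ : Set F := {y | (y, (0 : ℝ)) ∈ A} with hA₀
  have hA₀o : IsOpen A₀ := hA.preimage (by fun_prop : Continuous fun y : F => (y, (0 : ℝ)))
  have hA₀c : Convex ℝ A₀ := by
    intro x hx y hy a b ha hb hab
    have := hAc hx hy ha hb hab
    simpa [hA₀] using this
  have hfr : ∀ᵐ y ∂μ, y ∉ frontier A₀ := measure_eq_zero_iff_ae_notMem.1 (hA₀c.addHaar_frontier μ)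
  have hfr' : ∀ y, y ∉ frontier A₀ → (0 : ℝ) ∉ frontier (B y) := by
    intro y hy h0
    refine hy ?_
    have hBo : IsOpen (B y) := hA.preimage (hcontMk y)
    have hy0 : (y, (0 : ℝ)) ∉ A := by
      have := h0.2
      rwa [hBo.interior_eq] at this
    have hycl : (y, (0 : ℝ)) ∈ closure A :=
      map_mem_closure (hcontMk y) h0.1 fun t ht => ht
    refine ⟨?_, by rwa [hA₀o.interior_eq]⟩
    obtain ⟨y₀, hy₀⟩ := hne
    have hseg : openSegment ℝ y₀ y ⊆ A₀ := by
      rintro _ ⟨a, b, ha, hb, hab, rfl⟩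
      have := hAc.combo_interior_closure_mem_interior (by rwa [hA.interior_eq]) hycl ha hb.le hab
        (x := (y₀, (0 : ℝ)))
      simpa [hA.interior_eq, hA₀] using this
    have := closure_mono hseg
    rw [closure_openSegment] at this
    exact this (right_mem_segment ℝ y₀ y)
  have hind : ∫ y in A₀, ⟪w, y⟫_ℝ ∂μ
      = ∫ y, (B y).indicator (1 : ℝ → ℝ) 0 * ⟪w, y⟫_ℝ ∂μ := by
    rw [← integral_indicator hA₀o.measurableSet]
    refine integral_congr_ae (Filter.Eventually.of_forall fun y => ?_)
    by_cases hy : (y, (0 : ℝ)) ∈ A <;> simp [hA₀, hBdef, hy]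
  rw [hind]
  have hzero : ∀ y, y ∉ closedBall (0 : F) R → B y = ∅ := by
    intro y hy
    refine Set.eq_empty_of_forall_notMem fun t ht => hy ?_
    exact mem_closedBall_zero_iff.2 (hbd _ ht).1
  have hint0 : Integrable
      (fun y => (volume (B y ∩ Set.Ici (-((0 : ℝ) * ⟪w, y⟫_ℝ)))).toReal) μ := by
    refine Integrable.mono' (g := (closedBall (0 : F) R).indicator fun _ => 2 * R) ?_
      (hmeas 0).ennreal_toReal.aestronglyMeasurable (Filter.Eventually.of_forall fun y => ?_)
    · exact (integrable_indicator_iff measurableSet_closedBall).2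
        (integrableOn_const measure_closedBall_lt_top.ne)
    · by_cases hy : y ∈ closedBall (0 : F) R
      · have hR0 : 0 ≤ R := (norm_nonneg y).trans (mem_closedBall_zero_iff.1 hy)
        rw [Set.indicator_of_mem hy, Real.norm_of_nonneg ENNReal.toReal_nonneg]
        refine ENNReal.toReal_le_of_le_ofReal (by positivity) ?_
        refine (measure_mono (t := Set.Icc (-R) R) fun t ht => ?_).trans ?_
        · exact abs_le.1 (hbd _ ht.1).2
        · rw [Real.volume_Icc]
          exact le_of_eq (by ring_nf)
      · simp [hzero y hy, Set.indicator_of_notMem hy]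
  refine (hasDerivAt_integral_of_dominated_loc_of_lip
    (bound := (closedBall (0 : F) R).indicator fun y => ⟪w, y⟫_ℝ) Filter.univ_mem
    (Filter.Eventually.of_forall fun s => (hmeas s).ennreal_toReal.aestronglyMeasurable) hint0
    ?_ ?_ ?_ ?_).2
  · have : (fun y => (B y).indicator (1 : ℝ → ℝ) 0 * ⟪w, y⟫_ℝ)
        = A₀.indicator fun y => ⟪w, y⟫_ℝ := by
      ext y
      by_cases hy : (y, (0 : ℝ)) ∈ A <;> simp [hA₀, hBdef, hy]
    rw [this]
    exact (by fun_prop : Continuous fun y => ⟪w, y⟫_ℝ).aestronglyMeasurable.indicator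
      hA₀o.measurableSet
  · refine Filter.Eventually.of_forall fun y => LipschitzOnWith.of_dist_le_mul fun s _ t _ => ?_
    by_cases hy : y ∈ closedBall (0 : F) R
    · rw [Set.indicator_of_mem hy, Real.dist_eq, Real.dist_eq, Real.coe_nnabs]
      refine (abs_volume_inter_Ici_sub_le (hBm y) (hBfin y) _ _).trans (le_of_eq ?_)
      rw [← abs_mul, ← abs_neg]
      congr 1
      ring
    · simp only [hzero y hy, Set.empty_inter, dist_self]
      positivity
  · exact (integrable_indicator_iff measurableSet_closedBall).2
      ((by fun_prop : Continuous fun y => ⟪w, y⟫_ℝ).continuousOn.integrableOn_compact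
        (isCompact_closedBall _ _))
  · filter_upwards [hfr] with y hy
    exact hasDerivAt_volume_inter_Ici (hBm y) (hBfin y) (hfr' y hy) _

theorem setIntegral_eq_zero_of_forall_inner {F : Type*} [NormedAddCommGroup F]
    [InnerProductSpace ℝ F] [CompleteSpace F] [MeasurableSpace F] {μ : Measure F} {s : Set F}
    (hint : IntegrableOn (fun y => y) s μ) (h : ∀ w : F, ∫ y in s, ⟪w, y⟫_ℝ ∂μ = 0) :
    ∫ y in s, y ∂μ = 0 := by
  have := h (∫ y in s, y ∂μ)
  rw [integral_inner hint] at this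
  exact inner_self_eq_zero.1 this

noncomputable def orthogonalProdEquiv {E : Type*} [NormedAddCommGroup E] [InnerProductSpace ℝ E]
    [FiniteDimensional ℝ E] (v : E) (hv : ‖v‖ = 1) : ((ℝ ∙ v)ᗮ × ℝ) ≃L[ℝ] E :=
  (LinearEquiv.ofBijective
    ((ℝ ∙ v)ᗮ.subtype.coprod (LinearMap.toSpanSingleton ℝ E v)) (by
      have hvv : ⟪v, v⟫_ℝ = 1 := by rw [real_inner_self_eq_norm_sq, hv, one_pow]
      constructor
      · refine (injective_iff_map_eq_zero _).2 ?_
        rintro ⟨y, t⟩ h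
        have hy : ⟪v, (y : E)⟫_ℝ = 0 := Submodule.mem_orthogonal_singleton_iff_inner_right.1 y.2
        simp only [LinearMap.coprod_apply, Submodule.subtype_apply,
          LinearMap.toSpanSingleton_apply] at h
        have ht : t = 0 := by
          have := congrArg (fun x => ⟪v, x⟫_ℝ) h
          simpa only [inner_add_right, inner_smul_right, hy, hvv, zero_add, mul_one,
            inner_zero_right] using this
        subst ht
        simpa using h
      · intro x
        refine ⟨(⟨x - ⟪v, x⟫_ℝ • v, ?_⟩, ⟪v, x⟫_ℝ), by simp⟩
        rw [Submodule.mem_orthogonal_singleton_iff_inner_right, inner_sub_right, inner_smul_right,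
          hvv, mul_one, sub_self])).toContinuousLinearEquiv

theorem orthogonalProdEquiv_apply {E : Type*} [NormedAddCommGroup E] [InnerProductSpace ℝ E]
    [FiniteDimensional ℝ E] (v : E) (hv : ‖v‖ = 1) (p : (ℝ ∙ v)ᗮ × ℝ) :
    orthogonalProdEquiv v hv p = (p.1 : E) + p.2 • v := rfl

theorem exists_measure_eq_mul_prod {E : Type*} [NormedAddCommGroup E] [InnerProductSpace ℝ E]
    [FiniteDimensional ℝ E] [MeasurableSpace E] [BorelSpace E] (ν : Measure E) [ν.IsAddHaarMeasure]
    (v : E) (hv : ‖v‖ = 1) (μ : Measure (ℝ ∙ v)ᗮ) [μ.IsAddHaarMeasure] (z : E) :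
    ∃ c : ℝ, 0 < c ∧ ∀ S : Set E, (ν S).toReal
      = c * ((μ.prod volume) {p | z + orthogonalProdEquiv v hv p ∈ S}).toReal := by
  set L := orthogonalProdEquiv v hv
  set ρ := (μ.prod volume).map L
  have : ρ.IsAddHaarMeasure := L.isAddHaarMeasure_map _
  refine ⟨ν.addHaarScalarFactor ρ,
    NNReal.coe_pos.2 (Measure.addHaarScalarFactor_pos_of_isAddHaarMeasure ν ρ), fun S => ?_⟩
  have h1 : ν S = ν ((fun x => z + x) ⁻¹' S) := (measure_preimage_add ν z S).symm
  have h2 : ρ ((fun x => z + x) ⁻¹' S) = (μ.prod volume) {p | z + L p ∈ S} :=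
    L.toHomeomorph.toMeasurableEquiv.map_apply _
  have h3 : ν ((fun x => z + x) ⁻¹' S)
      = (ν.addHaarScalarFactor ρ • ρ) ((fun x => z + x) ⁻¹' S) :=
    congrArg (fun m : Measure E => m ((fun x => z + x) ⁻¹' S))
      (Measure.isAddLeftInvariant_eq_smul ν ρ)
  rw [h1, h3, Measure.smul_apply, h2, ENNReal.smul_def, smul_eq_mul, ENNReal.toReal_mul,
    ENNReal.coe_toReal]

theorem centroid_of_isMin_halfspace_volume {E : Type*} [NormedAddCommGroup E]
    [InnerProductSpace ℝ E] [FiniteDimensional ℝ E] [MeasurableSpace E] [BorelSpace E]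
    (ν : Measure E) [ν.IsAddHaarMeasure] {K : Set E} (hKo : IsOpen K) (hKb : IsBounded K)
    (hKc : Convex ℝ K) {v z : E} (hv : ‖v‖ = 1) {e : ℝ}
    (he : (Module.finrank ℝ (ℝ ∙ v)ᗮ : ℝ) = e)
    (hmin : ∀ u : E, ‖u‖ = 1 → (ν (K ∩ {x | 0 ≤ ⟪v, x - z⟫_ℝ})).toReal
      ≤ (ν (K ∩ {x | 0 ≤ ⟪u, x - z⟫_ℝ})).toReal)
    (hne : (K ∩ {x | ⟪v, x⟫_ℝ = ⟪v, z⟫_ℝ}).Nonempty) :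
    z = (μH[e] (K ∩ {x | ⟪v, x⟫_ℝ = ⟪v, z⟫_ℝ})).toReal⁻¹ •
      ∫ y in K ∩ {x | ⟪v, x⟫_ℝ = ⟪v, z⟫_ℝ}, y ∂μH[e] := by
  have hvv : ⟪v, v⟫_ℝ = 1 := by rw [real_inner_self_eq_norm_sq, hv, one_pow]
  have hvy : ∀ y : (ℝ ∙ v)ᗮ, ⟪v, (y : E)⟫_ℝ = 0 := fun y =>
    Submodule.mem_orthogonal_singleton_iff_inner_right.1 y.2
  set μ : Measure (ℝ ∙ v)ᗮ := μH[e] with hμ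
  have : μ.IsAddHaarMeasure := by
    rw [hμ, ← he]
    exact isAddHaarMeasure_hausdorffMeasure
  set L := orthogonalProdEquiv v hv with hL
  obtain ⟨c, hc, hνc⟩ := exists_measure_eq_mul_prod ν v hv μ z
  set A : Set ((ℝ ∙ v)ᗮ × ℝ) := {p | z + L p ∈ K} with hA
  have hAo : IsOpen A := hKo.preimage (by fun_prop)
  have hAc : Convex ℝ A := by
    intro p hp q hq a b ha hb hab
    have := hKc hp hq ha hb hab
    have e1 : a • (z + L p) + b • (z + L q) = z + L (a • p + b • q) := by
      rw [map_add, map_smul, map_smul, smul_add, smul_add, add_add_add_comm, ← add_smul, hab,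
        one_smul]
    rwa [e1] at this
  have hAb : IsBounded A := by
    have hAeq : A = L.symm '' ((fun x => -z + x) '' K) := by
      ext p
      constructor
      · intro hp
        exact ⟨L p, ⟨z + L p, hp, by simp⟩, by simp⟩
      · rintro ⟨_, ⟨x, hx, rfl⟩, rfl⟩
        simpa [hA] using hx
    rw [hAeq]
    refine L.symm.lipschitz.isBounded_image ?_
    exact (isometry_add_left (-z)).lipschitz.isBounded_image hKb
  set A₀ : Set (ℝ ∙ v)ᗮ := {y | (y, (0 : ℝ)) ∈ A} with hA₀
  set f : (ℝ ∙ v)ᗮ → E := fun y => z + y with hf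
  have hfiso : Isometry f := (isometry_add_left z).comp isometry_subtype_coe
  have hrange : Set.range f = {x | ⟪v, x⟫_ℝ = ⟪v, z⟫_ℝ} := by
    ext x
    constructor
    · rintro ⟨y, rfl⟩
      simp [hf, inner_add_right, hvy]
    · intro hx
      refine ⟨⟨x - z, ?_⟩, by simp [hf]⟩
      rw [Submodule.mem_orthogonal_singleton_iff_inner_right, inner_sub_right]
      exact sub_eq_zero.2 hx
  have hfA : f ⁻¹' K = A₀ := by
    ext y
    simp [hf, hA₀, hA, hL, orthogonalProdEquiv_apply]
  have hne₀ : ∃ y, (y, (0 : ℝ)) ∈ A := by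
    obtain ⟨x, hxK, hx⟩ := hne
    rw [← hrange] at hx
    obtain ⟨y, rfl⟩ := hx
    have : y ∈ f ⁻¹' K := hxK
    rw [hfA] at this
    exact ⟨y, this⟩
  have hA₀o : IsOpen A₀ := hAo.preimage (by fun_prop)
  have hA₀b : IsBounded A₀ := by
    rw [← hfA]
    exact hfiso.antilipschitz.isBounded_preimage hKb
  have hA₀fin : μ A₀ ≠ ⊤ := hA₀b.measure_lt_top.ne
  have hA₀pos : 0 < (μ A₀).toReal :=
    ENNReal.toReal_pos (hA₀o.measure_pos μ hne₀).ne' hA₀fin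
  have hint : IntegrableOn (fun y => y) A₀ μ := by
    obtain ⟨R, hR⟩ := hA₀b.subset_closedBall 0
    exact (continuous_id.continuousOn.integrableOn_compact (isCompact_closedBall _ _)).mono_set hR
  have hmoment : ∫ y in A₀, y ∂μ = 0 := by
    refine setIntegral_eq_zero_of_forall_inner hint fun w => ?_
    have hder := hasDerivAt_prod_inter_halfspace μ hAo hAc hAb hne₀ w
    refine IsLocalMin.hasDerivAt_eq_zero (Filter.Eventually.of_forall fun s => ?_) hder
    have hwv : ⟪(w : E), v⟫_ℝ = 0 := by rw [real_inner_comm]; exact hvy w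
    have hhalf : ∀ s : ℝ, (ν (K ∩ {x | 0 ≤ ⟪v + s • (w : E), x - z⟫_ℝ})).toReal
        = c * ((μ.prod volume) (A ∩ {p | 0 ≤ p.2 + s * ⟪w, p.1⟫_ℝ})).toReal := by
      intro s
      rw [hνc]
      congr 3
      ext p
      have : ⟪v + s • (w : E), (p.1 : E) + p.2 • v⟫_ℝ = p.2 + s * ⟪w, p.1⟫_ℝ := by
        simp only [inner_add_left, inner_add_right, inner_smul_left, inner_smul_right, hvy, hvv,
          hwv, Submodule.coe_inner, conj_trivial]
        ring
      simp [hA, hL, orthogonalProdEquiv_apply, this]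
    refine le_of_mul_le_mul_left ?_ hc
    rw [← hhalf, ← hhalf, zero_smul, add_zero]
    have hu0 : v + s • (w : E) ≠ 0 := by
      intro h
      have := congrArg (fun x => ⟪v, x⟫_ℝ) h
      simp [inner_add_right, inner_smul_right, hvy, hv] at this
    have hn : 0 < ‖v + s • (w : E)‖ := norm_pos_iff.2 hu0
    refine (hmin (‖v + s • (w : E)‖⁻¹ • (v + s • (w : E))) (norm_smul_inv_norm hu0)).trans
      (le_of_eq ?_)
    congr 3
    ext x
    simp only [Set.mem_ofPred_eq, inner_smul_left, conj_trivial]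
    rw [mul_nonneg_iff_of_pos_left (inv_pos.2 hn)]
  have he0 : 0 ≤ e := he ▸ Nat.cast_nonneg _
  have hmeas : (μH[e] : Measure E).restrict (K ∩ {x | ⟪v, x⟫_ℝ = ⟪v, z⟫_ℝ})
      = (μ.map f).restrict K := by
    rw [hfiso.map_hausdorffMeasure (Or.inl he0), hrange,
      Measure.restrict_restrict hKo.measurableSet]
  have hfme : MeasurableEmbedding f := hfiso.isClosedEmbedding.measurableEmbedding
  have hvol : (μH[e] : Measure E) (K ∩ {x | ⟪v, x⟫_ℝ = ⟪v, z⟫_ℝ}) = μ A₀ := by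
    rw [← hrange, Set.inter_comm, ← Set.image_preimage_eq_range_inter,
      hfiso.hausdorffMeasure_image (Or.inl he0), hfA]
  rw [hvol, hmeas, hfme.setIntegral_map, hfA]
  have hint' : IntegrableOn (fun y : (ℝ ∙ v)ᗮ => (y : E)) A₀ μ :=
    ((ℝ ∙ v)ᗮ.subtypeL).integrable_comp hint
  have hsub : ∫ y in A₀, (y : E) ∂μ = 0 := by
    have := ((ℝ ∙ v)ᗮ.subtypeL).integral_comp_comm hint
    simpa [hmoment] using this
  have hcst : IntegrableOn (fun _ : (ℝ ∙ v)ᗮ => z) A₀ μ := integrableOn_const hA₀fin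
  have hsum : ∫ y in A₀, f y ∂μ = (μ A₀).toReal • z := by
    rw [hf, integral_add hcst hint', hsub, setIntegral_const, add_zero, measureReal_def]
  rw [hsum, smul_smul, inv_mul_cancel₀ hA₀pos.ne', one_smul]

theorem continuous_volume_inter_halfspace {E : Type*} [NormedAddCommGroup E]
    [InnerProductSpace ℝ E] [FiniteDimensional ℝ E] [MeasurableSpace E] [BorelSpace E]
    (ν : Measure E) [ν.IsAddHaarMeasure] {K : Set E} (hKb : IsBounded K) :
    Continuous fun p : E × sphere (0 : E) 1 =>
      (ν (K ∩ {x | 0 ≤ ⟪(p.2 : E), x - p.1⟫_ℝ})).toReal := by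
  have hHm : ∀ p : E × sphere (0 : E) 1, MeasurableSet {x | 0 ≤ ⟪(p.2 : E), x - p.1⟫_ℝ} :=
    fun p => (isClosed_le (by fun_prop) (by fun_prop)).measurableSet
  have key : ∀ p : E × sphere (0 : E) 1, (ν (K ∩ {x | 0 ≤ ⟪(p.2 : E), x - p.1⟫_ℝ})).toReal
      = ∫ x in K, {t : ℝ | 0 ≤ t}.indicator (1 : ℝ → ℝ) ⟪(p.2 : E), x - p.1⟫_ℝ ∂ν := by
    intro p
    rw [Set.inter_comm, ← Measure.restrict_apply (hHm p), ← measureReal_def,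
      ← integral_indicator_one (hHm p)]
    rfl
  simp_rw [key]
  refine continuous_iff_continuousAt.2 fun p => ?_
  refine continuousAt_of_dominated (bound := fun _ => 1) (Filter.Eventually.of_forall fun q => ?_)
    (Filter.Eventually.of_forall fun q => Filter.Eventually.of_forall fun x => ?_)
    (integrableOn_const hKb.measure_lt_top.ne) ?_
  · exact (measurable_one.indicator (hHm q)).aestronglyMeasurable
  · exact (norm_indicator_le_norm_self _ _).trans (by simp)
  · have hv : ‖(p.2 : E)‖ = 1 := by simp
    have hnull : ν {x | ⟪(p.2 : E), x - p.1⟫_ℝ = 0} = 0 := by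
      have hne : (ℝ ∙ (p.2 : E))ᗮ ≠ ⊤ := by
        intro h
        have : (p.2 : E) ∈ (ℝ ∙ (p.2 : E))ᗮ := h ▸ Submodule.mem_top
        rw [Submodule.mem_orthogonal_singleton_iff_inner_right, real_inner_self_eq_norm_sq,
          hv] at this
        norm_num at this
      rw [← Measure.addHaar_submodule ν _ hne, ← measure_preimage_add_right ν (-p.1) ((ℝ ∙ (p.2 : E))ᗮ : Set E)]
      congr 1
      ext x
      simp [Submodule.mem_orthogonal_singleton_iff_inner_right, sub_eq_add_neg]
    refine ae_restrict_of_ae ?_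
    filter_upwards [measure_eq_zero_iff_ae_notMem.1 hnull] with x hx
    have hx' : ⟪(p.2 : E), x - p.1⟫_ℝ ∉ frontier {t : ℝ | 0 ≤ t} := by
      have : {t : ℝ | 0 ≤ t} = Set.Ici 0 := rfl
      rw [this, frontier_Ici]
      exact hx
    have h1 : ContinuousAt ({t : ℝ | 0 ≤ t}.indicator (1 : ℝ → ℝ)) ⟪(p.2 : E), x - p.1⟫_ℝ :=
      continuous_one.continuousOn.continuousAt_indicator hx'
    exact ContinuousAt.comp (f := fun q : E × sphere (0 : E) 1 => ⟪(q.2 : E), x - q.1⟫_ℝ) h1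
      (by fun_prop)

theorem volume_halfspace_ge_of_mem_depthRegion {d : ℕ} {K : Set (EuclideanSpace ℝ (Fin d))}
    {δ : ℝ} (hVpos : 0 < (volume K).toReal) {q v : EuclideanSpace ℝ (Fin d)}
    (hq : q ∈ depthRegion K δ) (hv : ‖v‖ = 1) :
    δ * (volume K).toReal ≤ (volume (K ∩ {x | 0 ≤ ⟪v, x - q⟫_ℝ})).toReal := by
  rw [← le_div_iff₀ hVpos]
  let f : {u : EuclideanSpace ℝ (Fin d) // ‖u‖ = 1} → ℝ := fun u =>
    (volume (K ∩ {x | 0 ≤ ⟪(u : EuclideanSpace ℝ (Fin d)), x - q⟫_ℝ})).toReal / (volume K).toReal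
  have hbdd : BddBelow (Set.range f) :=
    ⟨0, by rintro _ ⟨u, rfl⟩; exact div_nonneg ENNReal.toReal_nonneg ENNReal.toReal_nonneg⟩
  exact (show δ ≤ ⨅ u, f u from hq).trans (ciInf_le hbdd ⟨v, hv⟩)

theorem frontier_depthRegion_isMin {d : ℕ} (hd : 1 ≤ d) {K : Set (EuclideanSpace ℝ (Fin d))}
    (hKne : K.Nonempty) (hKopen : IsOpen K) (hKbdd : IsBounded K) {δ : ℝ}
    {z : EuclideanSpace ℝ (Fin d)} (hz : z ∈ frontier (depthRegion K δ)) :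
    z ∈ depthRegion K δ ∧ ∃ v : EuclideanSpace ℝ (Fin d), ‖v‖ = 1 ∧
      (volume (K ∩ {x | 0 ≤ ⟪v, x - z⟫_ℝ})).toReal ≤ δ * (volume K).toReal := by
  have hcont := continuous_volume_inter_halfspace
    (volume : Measure (EuclideanSpace ℝ (Fin d))) hKbdd
  have hVpos : 0 < (volume K).toReal :=
    ENNReal.toReal_pos (hKopen.measure_pos volume hKne).ne' hKbdd.measure_lt_top.ne
  have : Nonempty {v : EuclideanSpace ℝ (Fin d) // ‖v‖ = 1} := by
    have : Nontrivial (EuclideanSpace ℝ (Fin d)) :=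
      Module.nontrivial_of_finrank_pos (R := ℝ) (by rw [finrank_euclideanSpace_fin]; omega)
    obtain ⟨v, hv⟩ := exists_norm_eq (EuclideanSpace ℝ (Fin d)) zero_le_one
    exact ⟨⟨v, hv⟩⟩
  constructor
  · have hmem : z ∈ closure (depthRegion K δ) := hz.1
    show δ ≤ halfspaceDepth K z
    unfold halfspaceDepth
    refine le_ciInf fun v => ?_
    rw [le_div_iff₀ hVpos]
    have hv : ‖(v : EuclideanSpace ℝ (Fin d))‖ = 1 := v.2
    let u : sphere (0 : EuclideanSpace ℝ (Fin d)) 1 := ⟨v, mem_sphere_zero_iff_norm.2 hv⟩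
    have hpair : Continuous fun q : EuclideanSpace ℝ (Fin d) => (q, u) := by fun_prop
    have hcu := hcont.comp hpair
    have hcl := isClosed_le (continuous_const (y := δ * (volume K).toReal)) hcu
    refine closure_minimal (fun q hq => ?_) hcl hmem
    exact volume_halfspace_ge_of_mem_depthRegion hVpos hq hv
  · have hcl := isClosedMap_fst_of_compactSpace _ (isClosed_le hcont
      (continuous_const (y := δ * (volume K).toReal)))
    have hmem : z ∈ closure (depthRegion K δ)ᶜ := by
      rw [closure_compl]
      exact hz.2
    have hsub : (depthRegion K δ)ᶜ ⊆ Prod.fst ''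
        {p : EuclideanSpace ℝ (Fin d) × sphere (0 : EuclideanSpace ℝ (Fin d)) 1 |
          (volume (K ∩ {x | 0 ≤ ⟪(p.2 : EuclideanSpace ℝ (Fin d)), x - p.1⟫_ℝ})).toReal
            ≤ δ * (volume K).toReal} := by
      intro q hq
      obtain ⟨v, hv⟩ := exists_lt_of_ciInf_lt (not_le.1 (show ¬ δ ≤ halfspaceDepth K q from hq))
      rw [div_lt_iff₀ hVpos] at hv
      exact ⟨⟨q, ⟨v, mem_sphere_zero_iff_norm.2 v.2⟩⟩, hv.le, rfl⟩
    obtain ⟨⟨q, v⟩, hqv, rfl⟩ := closure_minimal hsub hcl hmem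
    exact ⟨v, by simp, hqv⟩

theorem stmt10 {d : ℕ} (hd : 1 ≤ d) (K : Set (EuclideanSpace ℝ (Fin d)))
    (hKne : K.Nonempty) (hKopen : IsOpen K) (hKbdd : IsBounded K) (hKconv : Convex ℝ K)
    (δ : ℝ) (hδ0 : 0 < δ) (hδ1 : δ ≤ 1 / 2)
    (z : EuclideanSpace ℝ (Fin d)) (hz : z ∈ frontier (depthRegion K δ)) :
    ∃ (v : EuclideanSpace ℝ (Fin d)) (c : ℝ), ‖v‖ = 1 ∧
      ⟪v, z⟫_ℝ = c ∧
      (∀ y ∈ depthRegion K δ, ⟪v, y⟫_ℝ ≤ c) ∧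
      (volume (K ∩ {y | c ≤ ⟪v, y⟫_ℝ})).toReal = δ * (volume K).toReal ∧
      {y : EuclideanSpace ℝ (Fin d) | ⟪v, y⟫_ℝ = c} ∩ depthRegion K δ = {z} ∧
      z = ((μH[(d : ℝ) - 1] : Measure (EuclideanSpace ℝ (Fin d)))
              (K ∩ {y | ⟪v, y⟫_ℝ = c})).toReal⁻¹ •
            ∫ y in K ∩ {y | ⟪v, y⟫_ℝ = c}, y ∂(μH[(d : ℝ) - 1]) := by
  obtain ⟨hzmem, v, hv, hvle⟩ := frontier_depthRegion_isMin hd hKne hKopen hKbdd hz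
  have hKfin : volume K ≠ ⊤ := hKbdd.measure_lt_top.ne
  have hVpos : 0 < (volume K).toReal :=
    ENNReal.toReal_pos (hKopen.measure_pos volume hKne).ne' hKfin
  have hge : ∀ {q u : EuclideanSpace ℝ (Fin d)}, q ∈ depthRegion K δ → ‖u‖ = 1 →
      δ * (volume K).toReal ≤ (volume (K ∩ {x | 0 ≤ ⟪u, x - q⟫_ℝ})).toReal :=
    fun hq hu => volume_halfspace_ge_of_mem_depthRegion hVpos hq hu
  have hset : ∀ q : EuclideanSpace ℝ (Fin d),
      {x | 0 ≤ ⟪v, x - q⟫_ℝ} = {x | ⟪v, q⟫_ℝ ≤ ⟪v, x⟫_ℝ} := by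
    intro q
    ext x
    simp only [Set.mem_ofPred_eq, inner_sub_right, sub_nonneg]
  have hvol : (volume (K ∩ {x | ⟪v, z⟫_ℝ ≤ ⟪v, x⟫_ℝ})).toReal = δ * (volume K).toReal := by
    rw [← hset]
    exact le_antisymm hvle (hge hzmem hv)
  have hpos : 0 < δ * (volume K).toReal := by positivity
  obtain ⟨p, hpK, hp⟩ : (K ∩ {x | ⟪v, z⟫_ℝ ≤ ⟪v, x⟫_ℝ}).Nonempty := by
    by_contra h
    rw [Set.not_nonempty_iff_eq_empty] at h
    rw [h, measure_empty, ENNReal.toReal_zero] at hvol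
    exact hpos.ne hvol
  obtain ⟨r, hrK, hr⟩ : ∃ r ∈ K, ⟪v, r⟫_ℝ < ⟪v, z⟫_ℝ := by
    by_contra! h
    rw [Set.inter_eq_left.2 (show K ⊆ {x | ⟪v, z⟫_ℝ ≤ ⟪v, x⟫_ℝ} from h)] at hvol
    nlinarith
  have hstrict : ∃ p ∈ K, ⟪v, z⟫_ℝ < ⟪v, p⟫_ℝ := by
    have hlim : Filter.Tendsto (fun t : ℝ => p + t • v) (nhdsWithin 0 (Set.Ioi 0)) (nhds p) := by
      have : Continuous fun t : ℝ => p + t • v := by fun_prop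
      exact (this.tendsto' 0 p (by simp)).mono_left nhdsWithin_le_nhds
    obtain ⟨t, htK, ht⟩ :=
      ((hlim.eventually (hKopen.mem_nhds hpK)).and self_mem_nhdsWithin).exists
    refine ⟨p + t • v, htK, ?_⟩
    rw [inner_add_right, inner_smul_right, real_inner_self_eq_norm_sq, hv, one_pow, mul_one]
    exact lt_of_le_of_lt hp (lt_add_of_pos_right _ ht)
  obtain ⟨p', hp'K, hp'⟩ := hstrict
  have hlevel : ∀ a : ℝ, ⟪v, r⟫_ℝ ≤ a → a ≤ ⟪v, p'⟫_ℝ → ∃ x ∈ K, ⟪v, x⟫_ℝ = a := by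
    intro a h1 h2
    exact hKconv.isPreconnected.intermediate_value hrK hp'K
      (by fun_prop : Continuous fun x => ⟪v, x⟫_ℝ).continuousOn ⟨h1, h2⟩
  have hcentroid : ∀ q ∈ depthRegion K δ, ⟪v, q⟫_ℝ = ⟪v, z⟫_ℝ →
      q = ((μH[(d : ℝ) - 1] : Measure (EuclideanSpace ℝ (Fin d)))
              (K ∩ {y | ⟪v, y⟫_ℝ = ⟪v, z⟫_ℝ})).toReal⁻¹ •
            ∫ y in K ∩ {y | ⟪v, y⟫_ℝ = ⟪v, z⟫_ℝ}, y ∂(μH[(d : ℝ) - 1]) := by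
    intro q hq hqz
    rw [← hqz]
    refine centroid_of_isMin_halfspace_volume volume hKopen hKbdd hKconv hv ?_ (fun u hu => ?_) ?_
    · have : Fact (Module.finrank ℝ (EuclideanSpace ℝ (Fin d)) = (d - 1) + 1) :=
        ⟨by rw [finrank_euclideanSpace_fin]; omega⟩
      rw [Submodule.finrank_orthogonal_span_singleton (n := d - 1)
        (norm_pos_iff.1 (by rw [hv]; exact one_pos)), Nat.cast_sub hd, Nat.cast_one]
    · rw [hset, hqz, hvol]
      exact hge hq hu
    · obtain ⟨x, hxK, hx⟩ := hlevel ⟪v, q⟫_ℝ (by rw [hqz]; exact hr.le) (by rw [hqz]; exact hp'.le)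
      exact ⟨x, hxK, hx⟩
  refine ⟨v, ⟪v, z⟫_ℝ, hv, rfl, fun y hy => ?_, hvol, ?_, hcentroid z hzmem rfl⟩
  · by_contra! hlt
    have hle : δ * (volume K).toReal ≤ (volume (K ∩ {x | ⟪v, y⟫_ℝ ≤ ⟪v, x⟫_ℝ})).toReal := by
      rw [← hset]
      exact hge hy hv
    set S : Set (EuclideanSpace ℝ (Fin d)) :=
      K ∩ {x | ⟪v, z⟫_ℝ < ⟪v, x⟫_ℝ ∧ ⟪v, x⟫_ℝ < ⟪v, y⟫_ℝ} with hS
    have hcv : Continuous fun x => ⟪v, x⟫_ℝ := by fun_prop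
    have hSo : IsOpen S := hKopen.inter
      ((isOpen_lt continuous_const hcv).and (isOpen_lt hcv continuous_const))
    have hSne : S.Nonempty := by
      obtain ⟨a, ha1, ha2⟩ := exists_between (lt_min hp' hlt)
      obtain ⟨x, hxK, hx⟩ := hlevel a (hr.le.trans ha1.le) (ha2.le.trans (min_le_left _ _))
      refine ⟨x, hxK, ?_, ?_⟩
      · rw [hx]; exact ha1
      · rw [hx]; exact ha2.trans_le (min_le_right _ _)
    have hSfin : volume S ≠ ⊤ := measure_ne_top_of_subset Set.inter_subset_left hKfin
    have hSpos : 0 < (volume S).toReal :=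
      ENNReal.toReal_pos (hSo.measure_pos volume hSne).ne' hSfin
    have hdisj : Disjoint (K ∩ {x | ⟪v, y⟫_ℝ ≤ ⟪v, x⟫_ℝ}) S :=
      Set.disjoint_left.2 fun x hx hxS => not_le.2 hxS.2.2 hx.2
    have hsub : (K ∩ {x | ⟪v, y⟫_ℝ ≤ ⟪v, x⟫_ℝ}) ∪ S ⊆ K ∩ {x | ⟪v, z⟫_ℝ ≤ ⟪v, x⟫_ℝ} := by
      rintro x (hx | hx)
      · exact ⟨hx.1, hlt.le.trans hx.2⟩
      · exact ⟨hx.1, hx.2.1.le⟩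
    have hmono := ENNReal.toReal_mono
      (measure_ne_top_of_subset Set.inter_subset_left hKfin) (measure_mono hsub (μ := volume))
    rw [measure_union hdisj hSo.measurableSet, ENNReal.toReal_add
      (measure_ne_top_of_subset Set.inter_subset_left hKfin) hSfin, hvol] at hmono
    linarith
  · ext y
    constructor
    · rintro ⟨hy, hyK⟩
      exact (hcentroid y hyK hy).trans (hcentroid z hzmem rfl).symm
    · rintro rfl
      exact ⟨rfl, hzmem⟩
end
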